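/- arXiv:2212.06999 — 2 statements merged into one kernel-verified Lean document; each statement's English description precedes it below -/
import Mathlib

section
/- Let I = ⟨m₁,…,m_r⟩ be a monomial ideal in Q = 𝕜[x₁,…,xₙ], let a₁,…,a_c be a regular sequence of homogeneous polynomials of positive degree contained in I, and set R = Q/⟨a₁,…,a_c⟩ with graded maximal ideal 𝔪_R = (x₁,…,xₙ)R. Then for every m ≥ 0, the even total Betti numbers of R/I over R satisfy β_{2m}(R/I) = dim_𝕜 Tor_{2m}^R(R/𝔪_R, R/IR) ≤ Σ_{j=0}^{m} C(r, 2j) · C(c + m − j − 1, c − 1). -/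
open MvPolynomial CategoryTheory

set_option synthInstance.maxHeartbeats 1000000
set_option maxHeartbeats 1000000

/-- The complete intersection ring `R = Q/⟨a₁,…,a_c⟩`. -/
abbrev CIRing (𝕜 : Type*) [Field 𝕜] (n c : ℕ) (a : Fin c → MvPolynomial (Fin n) 𝕜) :=
  MvPolynomial (Fin n) 𝕜 ⧸ Ideal.span (Set.range a)

/-- The graded maximal ideal `𝔪_R = (x₁,…,xₙ)R` of `R`. -/
noncomputable def gradedMaxIdeal (𝕜 : Type*) [Field 𝕜] (n c : ℕ)
    (a : Fin c → MvPolynomial (Fin n) 𝕜) : Ideal (CIRing 𝕜 n c a) :=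
  Ideal.span (Set.range fun i : Fin n =>
    algebraMap (MvPolynomial (Fin n) 𝕜) (CIRing 𝕜 n c a) (X i))

/-- The extension `IR` of the monomial ideal `I = ⟨m₁,…,m_r⟩` to `R`. -/
noncomputable def extIdeal (𝕜 : Type*) [Field 𝕜] {n r : ℕ} (c : ℕ)
    (v : Fin r → (Fin n →₀ ℕ)) (a : Fin c → MvPolynomial (Fin n) 𝕜) :
    Ideal (CIRing 𝕜 n c a) :=
  Ideal.map (algebraMap (MvPolynomial (Fin n) 𝕜) (CIRing 𝕜 n c a))
    (Ideal.span (Set.range fun j => monomial (v j) (1 : 𝕜)))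

open scoped TensorProduct

universe u

namespace LinearMap

lemma mem_range_sup_iff {A M N : Type*} [CommRing A] [AddCommGroup M] [Module A M]
    [AddCommGroup N] [Module A N] (f : M →ₗ[A] N) (P : Submodule A N) (x : N) :
    x ∈ range f ⊔ P ↔ ∃ w, x - f w ∈ P := by
  rw [Submodule.mem_sup]
  constructor
  · rintro ⟨_, ⟨w, rfl⟩, z, hz, rfl⟩
    exact ⟨w, by simpa using hz⟩
  · rintro ⟨w, hw⟩
    exact ⟨f w, ⟨w, rfl⟩, _, hw, by simp⟩

lemma map_mem_smul_top {A M N : Type*} [CommRing A] [AddCommGroup M] [Module A M]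
    [AddCommGroup N] [Module A N] (f : M →ₗ[A] N) (J : Ideal A) {x : M}
    (hx : x ∈ (J • ⊤ : Submodule A M)) : f x ∈ (J • ⊤ : Submodule A N) :=
  Submodule.smul_top_le_comap_smul_top J f hx

end LinearMap

lemma Submodule.mem_smul_top_prod_iff {A M N : Type*} [CommRing A] [AddCommGroup M] [Module A M]
    [AddCommGroup N] [Module A N] (J : Ideal A) (x : M) (y : N) :
    (x, y) ∈ (J • ⊤ : Submodule A (M × N)) ↔
      x ∈ (J • ⊤ : Submodule A M) ∧ y ∈ (J • ⊤ : Submodule A N) := by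
  constructor
  · intro h
    exact ⟨LinearMap.map_mem_smul_top (LinearMap.fst A M N) J h,
      LinearMap.map_mem_smul_top (LinearMap.snd A M N) J h⟩
  · rintro ⟨hx, hy⟩
    have h₁ := LinearMap.map_mem_smul_top (LinearMap.inl A M N) J hx
    have h₂ := LinearMap.map_mem_smul_top (LinearMap.inr A M N) J hy
    simpa using add_mem h₁ h₂

/-- A nonzerodivisor modulo `J` acts injectively on `X / J X` for `X` projective. -/
lemma Module.Projective.mem_smul_top_of_smul_mem {A X : Type*} [CommRing A] [AddCommGroup X]
    [Module A X] [Module.Projective A X] {J : Ideal A} {a : A}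
    (ha : ∀ q, a * q ∈ J → q ∈ J) {x : X} (hx : a • x ∈ (J • ⊤ : Submodule A X)) :
    x ∈ (J • ⊤ : Submodule A X) := by
  obtain ⟨s, hs⟩ := Module.projective_def'.mp ‹Module.Projective A X›
  have hs' : Finsupp.linearCombination A id (s x) = x := congr($hs x)
  rw [← hs', Finsupp.linearCombination_apply]
  refine Submodule.sum_mem _ fun i _ ↦ Submodule.smul_mem_smul (ha _ ?_) trivial
  have h := LinearMap.map_mem_smul_top (Finsupp.lapply i ∘ₗ s) J hx
  simpa using h

lemma Module.Projective.exists_lift {A X Y Z : Type*} [CommRing A] [AddCommGroup X] [Module A X]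
    [AddCommGroup Y] [Module A Y] [AddCommGroup Z] [Module A Z] [Module.Projective A X]
    (g : Y →ₗ[A] Z) (f : X →ₗ[A] Z) (hf : ∀ x, f x ∈ LinearMap.range g) :
    ∃ φ : X →ₗ[A] Y, ∀ x, g (φ x) = f x := by
  obtain ⟨φ, hφ⟩ := Module.projective_lifting_property g.rangeRestrict (f.codRestrict _ hf)
    g.surjective_rangeRestrict
  exact ⟨φ, fun x ↦ congr_arg Subtype.val congr($hφ x)⟩

lemma LinearMap.rank_le_add_of_exact {K V W U : Type u} [Field K] [AddCommGroup V] [Module K V]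
    [AddCommGroup W] [Module K W] [AddCommGroup U] [Module K U] (f : V →ₗ[K] W) (g : W →ₗ[K] U)
    (h : ∀ y, g y = 0 → ∃ x, f x = y) :
    Module.rank K W ≤ Module.rank K V + Module.rank K U := by
  rw [← LinearMap.rank_range_add_rank_ker g, add_comm]
  refine add_le_add (le_trans ?_ (rank_range_le f)) (Submodule.rank_le _)
  exact Submodule.rank_mono fun y hy ↦ h y hy

/-- The dimension over `𝕜` of a module over a `𝕜`-algebra. -/
noncomputable def restrictRank (𝕜 A N : Type u) [Field 𝕜] [CommRing A] [Algebra 𝕜 A]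
    [AddCommGroup N] [Module A N] : Cardinal.{u} :=
  letI := Module.compHom N (algebraMap 𝕜 A)
  Module.rank 𝕜 N

section Rank

variable {𝕜 A B : Type u} [Field 𝕜] [CommRing A] [Algebra 𝕜 A] [CommRing B] [Algebra 𝕜 B]

/-- A semilinear map over a homomorphism of `𝕜`-algebras, regarded as a `𝕜`-linear map. -/
abbrev LinearMap.compHomₛₗ {σ : A →+* B} (hσ : ∀ c : 𝕜, σ (algebraMap 𝕜 A c) = algebraMap 𝕜 B c)
    {M N : Type u} [AddCommGroup M] [Module A M] [AddCommGroup N] [Module B N]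
    (f : M →ₛₗ[σ] N) :
    letI := Module.compHom M (algebraMap 𝕜 A)
    letI := Module.compHom N (algebraMap 𝕜 B)
    M →ₗ[𝕜] N :=
  letI := Module.compHom M (algebraMap 𝕜 A)
  letI := Module.compHom N (algebraMap 𝕜 B)
  { toFun := f
    map_add' := f.map_add
    map_smul' := fun c x ↦ by
      have h := f.map_smulₛₗ (algebraMap 𝕜 A c) x
      rw [hσ] at h
      exact h }

lemma restrictRank_le_of_surjective {σ : A →+* B}
    (hσ : ∀ c : 𝕜, σ (algebraMap 𝕜 A c) = algebraMap 𝕜 B c)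
    {M N : Type u} [AddCommGroup M] [Module A M] [AddCommGroup N] [Module B N]
    (f : M →ₛₗ[σ] N) (hf : Function.Surjective f) :
    restrictRank 𝕜 B N ≤ restrictRank 𝕜 A M := by
  let := Module.compHom M (algebraMap 𝕜 A)
  let := Module.compHom N (algebraMap 𝕜 B)
  exact LinearMap.rank_le_of_surjective (f.compHomₛₗ hσ) hf

lemma restrictRank_le_of_injective {σ : A →+* B}
    (hσ : ∀ c : 𝕜, σ (algebraMap 𝕜 A c) = algebraMap 𝕜 B c)
    {M N : Type u} [AddCommGroup M] [Module A M] [AddCommGroup N] [Module B N]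
    (f : M →ₛₗ[σ] N) (hf : Function.Injective f) :
    restrictRank 𝕜 A M ≤ restrictRank 𝕜 B N := by
  let := Module.compHom M (algebraMap 𝕜 A)
  let := Module.compHom N (algebraMap 𝕜 B)
  exact LinearMap.rank_le_of_injective (f.compHomₛₗ hσ) hf

lemma LinearEquiv.restrictRank_eq {M N : Type u} [AddCommGroup M] [Module A M] [AddCommGroup N]
    [Module A N] (e : M ≃ₗ[A] N) : restrictRank 𝕜 A M = restrictRank 𝕜 A N :=
  le_antisymm
    (restrictRank_le_of_injective (σ := RingHom.id A) (fun _ ↦ rfl) e.toLinearMap e.injective)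
    (restrictRank_le_of_injective (σ := RingHom.id A) (fun _ ↦ rfl) e.symm.toLinearMap
      e.symm.injective)

lemma restrictRank_le_add {M N P : Type u} [AddCommGroup M] [Module A M] [AddCommGroup N]
    [Module A N] [AddCommGroup P] [Module A P] (f : M →ₗ[A] N) (g : N →ₗ[A] P)
    (h : ∀ y, g y = 0 → ∃ x, f x = y) :
    restrictRank 𝕜 A N ≤ restrictRank 𝕜 A M + restrictRank 𝕜 A P := by
  let := Module.compHom M (algebraMap 𝕜 A)
  let := Module.compHom N (algebraMap 𝕜 A)
  let := Module.compHom P (algebraMap 𝕜 A)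
  exact LinearMap.rank_le_add_of_exact (f.compHomₛₗ (𝕜 := 𝕜) (σ := RingHom.id A) fun _ ↦ rfl)
    (g.compHomₛₗ (𝕜 := 𝕜) (σ := RingHom.id A) fun _ ↦ rfl) h

variable (𝕜) in
lemma restrictRank_subquotient_le_add {X Y W : Type u} [AddCommGroup X] [Module A X]
    [AddCommGroup Y] [Module A Y] [AddCommGroup W] [Module A W] (f : X →ₗ[A] Y) (g : Y →ₗ[A] W)
    {ZX BX : Submodule A X} {ZY BY : Submodule A Y} {ZW BW : Submodule A W}
    (hfZ : ∀ x ∈ ZX, f x ∈ ZY) (hfB : ∀ x ∈ BX, f x ∈ BY)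
    (hgZ : ∀ y ∈ ZY, g y ∈ ZW) (hgB : ∀ y ∈ BY, g y ∈ BW)
    (h : ∀ y ∈ ZY, g y ∈ BW → ∃ x ∈ ZX, y - f x ∈ BY) :
    restrictRank 𝕜 A (ZY ⧸ BY.submoduleOf ZY) ≤
      restrictRank 𝕜 A (ZX ⧸ BX.submoduleOf ZX) + restrictRank 𝕜 A (ZW ⧸ BW.submoduleOf ZW) := by
  refine restrictRank_le_add (Submodule.mapQ _ _ (f.restrict hfZ) fun x hx ↦ hfB _ hx)
    (Submodule.mapQ _ _ (g.restrict hgZ) fun y hy ↦ hgB _ hy) fun y hy ↦ ?_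
  obtain ⟨⟨y, hyZ⟩, rfl⟩ := Submodule.mkQ_surjective _ y
  obtain ⟨x, hx, hxy⟩ := h y hyZ ((Submodule.Quotient.mk_eq_zero (BW.submoduleOf ZW)).mp hy)
  refine ⟨Submodule.mkQ _ ⟨x, hx⟩, ((Submodule.Quotient.eq _).mpr ?_).symm⟩
  exact hxy

lemma restrictRank_subquotient_le {σ : A →+* B}
    (hσ : ∀ c : 𝕜, σ (algebraMap 𝕜 A c) = algebraMap 𝕜 B c)
    {X Y : Type u} [AddCommGroup X] [Module A X] [AddCommGroup Y] [Module B Y] (f : X →ₛₗ[σ] Y)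
    {ZX BX : Submodule A X} {ZY BY : Submodule B Y}
    (hfZ : ∀ x ∈ ZX, f x ∈ ZY) (hfB : ∀ x ∈ BX, f x ∈ BY)
    (h : ∀ y ∈ ZY, ∃ x ∈ ZX, y - f x ∈ BY) :
    restrictRank 𝕜 B (ZY ⧸ BY.submoduleOf ZY) ≤ restrictRank 𝕜 A (ZX ⧸ BX.submoduleOf ZX) := by
  refine restrictRank_le_of_surjective hσ (Submodule.mapQ (BX.submoduleOf ZX) (BY.submoduleOf ZY)
    ((f.domRestrict ZX).codRestrict ZY fun x ↦ hfZ x x.2) fun x hx ↦ hfB _ hx) fun y ↦ ?_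
  obtain ⟨⟨y, hyZ⟩, rfl⟩ := Submodule.mkQ_surjective _ y
  obtain ⟨x, hx, hxy⟩ := h y hyZ
  refine ⟨Submodule.mkQ _ ⟨x, hx⟩, ((Submodule.Quotient.eq (BY.submoduleOf ZY)).mpr ?_).symm⟩
  exact hxy

end Rank

/-- A sequence of projective modules and maps that becomes a resolution of `M` modulo the
ideal `J`. -/
structure ResolutionMod {A : Type u} [CommRing A] (J : Ideal A) (M : Type u) [AddCommGroup M]
    [Module A M] where
  /-- the modules -/
  X : ℕ → ModuleCat.{u} A
  projective : ∀ i, Module.Projective A (X i)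
  /-- the maps, composing to zero modulo `J` -/
  d : ∀ i, X (i + 1) →ₗ[A] X i
  /-- the augmentation -/
  ε : X 0 →ₗ[A] M
  surjective_ε : Function.Surjective ε
  ker_ε : LinearMap.ker ε = LinearMap.range (d 0) ⊔ J • ⊤
  comap_d : ∀ i, (J • ⊤ : Submodule A (X i)).comap (d i) = LinearMap.range (d (i + 1)) ⊔ J • ⊤

namespace ResolutionMod

variable {A : Type u} [CommRing A] {J K : Ideal A} {M : Type u} [AddCommGroup M] [Module A M]

attribute [instance] ResolutionMod.projective

section

variable (P : ResolutionMod J M)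

lemma exists_sub_mem_of_d_mem {i : ℕ} {x : P.X (i + 1)} (hx : P.d i x ∈ (J • ⊤ : Submodule A _)) :
    ∃ w, x - P.d (i + 1) w ∈ (J • ⊤ : Submodule A _) :=
  (LinearMap.mem_range_sup_iff _ _ _).mp ((P.comap_d i).le hx)

lemma d_d_mem {i : ℕ} (x : P.X (i + 2)) : P.d i (P.d (i + 1) x) ∈ (J • ⊤ : Submodule A _) :=
  (P.comap_d i).ge (Submodule.mem_sup_left ⟨x, rfl⟩)

/-- Elements that are cycles modulo `K`. -/
def cycles (K : Ideal A) : ∀ i, Submodule A (P.X i)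
  | 0 => ⊤
  | i + 1 => (K • ⊤ : Submodule A (P.X i)).comap (P.d i)

/-- Elements that are boundaries modulo `K`. -/
def boundaries (K : Ideal A) (i : ℕ) : Submodule A (P.X i) :=
  LinearMap.range (P.d i) ⊔ K • ⊤

/-- The homology of the sequence modulo `K`. -/
abbrev homology (K : Ideal A) (i : ℕ) : Type u :=
  P.cycles K i ⧸ (P.boundaries K i).submoduleOf (P.cycles K i)

lemma mem_boundaries_iff {i : ℕ} {x : P.X i} :
    x ∈ P.boundaries K i ↔ ∃ w, x - P.d i w ∈ (K • ⊤ : Submodule A _) :=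
  LinearMap.mem_range_sup_iff _ _ _

end

section Homotopy

/-- The homotopy measuring the failure of the maps to compose to zero, when the ideal is
enlarged by one element. -/
lemma exists_homotopy {a : A} (P : ResolutionMod (J ⊔ Ideal.span {a}) M) (i : ℕ) :
    ∃ t : P.X (i + 2) →ₗ[A] P.X i, ∀ x,
      P.d i (P.d (i + 1) x) - a • t x ∈ (J • ⊤ : Submodule A _) := by
  let N : Submodule A (P.X i) := J • ⊤
  let g : P.X i →ₗ[A] P.X i ⧸ N := a • N.mkQ
  let f : P.X (i + 2) →ₗ[A] P.X i ⧸ N := N.mkQ ∘ₗ P.d i ∘ₗ P.d (i + 1)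
  have hf : ∀ x, f x ∈ LinearMap.range g := by
    intro x
    have h := P.d_d_mem x
    rw [Submodule.sup_smul, Submodule.ideal_span_singleton_smul] at h
    obtain ⟨y, hy, z, hz, h⟩ := Submodule.mem_sup.mp h
    obtain ⟨w, -, rfl⟩ := (Submodule.mem_smul_pointwise_iff_exists _ _ _).mp hz
    refine ⟨w, ?_⟩
    have hy0 : N.mkQ y = 0 := by simpa using hy
    change a • N.mkQ w = N.mkQ (P.d i (P.d (i + 1) x))
    rw [← h, map_add, hy0, zero_add, map_smul]
  obtain ⟨t, ht⟩ := Module.Projective.exists_lift g f hf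
  refine ⟨t, fun x ↦ ?_⟩
  have h : a • N.mkQ (t x) = N.mkQ (P.d i (P.d (i + 1) x)) := ht x
  rw [← map_smul] at h
  exact (Submodule.Quotient.eq N).mp h.symm

/-- A choice of homotopy. -/
noncomputable def homotopy {a : A} (P : ResolutionMod (J ⊔ Ideal.span {a}) M) (i : ℕ) :
    P.X (i + 2) →ₗ[A] P.X i :=
  (P.exists_homotopy i).choose

variable {a : A} (P : ResolutionMod (J ⊔ Ideal.span {a}) M)

lemma d_d_sub_mem {i : ℕ} (x : P.X (i + 2)) :
    P.d i (P.d (i + 1) x) - a • P.homotopy i x ∈ (J • ⊤ : Submodule A _) :=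
  (P.exists_homotopy i).choose_spec x

lemma homotopy_d_sub_mem (ha : ∀ q, a * q ∈ J → q ∈ J) {i : ℕ} (x : P.X (i + 3)) :
    P.homotopy i (P.d (i + 2) x) - P.d i (P.homotopy (i + 1) x) ∈ (J • ⊤ : Submodule A _) := by
  refine Module.Projective.mem_smul_top_of_smul_mem ha ?_
  have h₁ := P.d_d_sub_mem (P.d (i + 2) x)
  have h₂ := LinearMap.map_mem_smul_top (P.d i) J (P.d_d_sub_mem x)
  rw [map_sub, map_smul] at h₂
  convert sub_mem h₂ h₁ using 1
  module

lemma exists_of_d_mem_sup {i : ℕ} {x : P.X (i + 1)}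
    (hx : P.d i x ∈ ((J ⊔ Ideal.span {a}) • ⊤ : Submodule A _)) :
    ∃ z w, x - P.d (i + 1) z - a • w ∈ (J • ⊤ : Submodule A _) := by
  obtain ⟨z, hz⟩ := P.exists_sub_mem_of_d_mem hx
  rw [Submodule.sup_smul, Submodule.ideal_span_singleton_smul] at hz
  obtain ⟨y, hy, v, hv, h⟩ := Submodule.mem_sup.mp hz
  obtain ⟨w, -, rfl⟩ := (Submodule.mem_smul_pointwise_iff_exists _ _ _).mp hv
  exact ⟨z, w, by rwa [← h, add_sub_cancel_right]⟩

lemma exists_lift_of_mem (ha : ∀ q, a * q ∈ J → q ∈ J) {i : ℕ} {x : P.X (i + 1)} {y : P.X i}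
    (h : P.d i x + a • y ∈ (J • ⊤ : Submodule A _)) :
    ∃ z w, x - (P.d (i + 1) z + a • w) ∈ (J • ⊤ : Submodule A _) ∧
      y - (-P.homotopy i z + -P.d i w) ∈ (J • ⊤ : Submodule A _) := by
  have hx : P.d i x ∈ ((J ⊔ Ideal.span {a}) • ⊤ : Submodule A (P.X i)) := by
    rw [Submodule.sup_smul, Submodule.ideal_span_singleton_smul]
    refine Submodule.mem_sup.mpr ⟨_, h, -(a • y), ?_, by simp⟩
    exact neg_mem (Submodule.smul_mem_pointwise_smul _ _ _ trivial)
  obtain ⟨z, w, hzw⟩ := P.exists_of_d_mem_sup hx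
  refine ⟨z, w, by rwa [sub_sub] at hzw, ?_⟩
  refine Module.Projective.mem_smul_top_of_smul_mem ha ?_
  have h₁ := LinearMap.map_mem_smul_top (P.d i) J hzw
  rw [map_sub, map_sub, map_smul] at h₁
  convert sub_mem h (add_mem h₁ (P.d_d_sub_mem z)) using 1
  module

lemma d_add_smul_mem {i : ℕ} {x : P.X (i + 1)} {y : P.X i} {z : P.X (i + 2)} {w : P.X (i + 1)}
    (h₁ : x - (P.d (i + 1) z + a • w) ∈ (J • ⊤ : Submodule A _))
    (h₂ : y - (-P.homotopy i z + -P.d i w) ∈ (J • ⊤ : Submodule A _)) :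
    P.d i x + a • y ∈ (J • ⊤ : Submodule A _) := by
  have h₃ := LinearMap.map_mem_smul_top (P.d i) J h₁
  have h₄ := Submodule.smul_mem _ a h₂
  simp only [map_sub, map_add, map_smul] at h₃
  convert add_mem (add_mem h₃ h₄) (P.d_d_sub_mem z) using 1
  module

/-- The modules of the resolution modulo the smaller ideal. -/
def descentX : ℕ → ModuleCat.{u} A
  | 0 => P.X 0
  | i + 1 => ModuleCat.of A (P.X (i + 1) × P.X i)

/-- The maps of the resolution modulo the smaller ideal. -/
noncomputable def descentD : ∀ i, P.descentX (i + 1) →ₗ[A] P.descentX i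
  | 0 => (P.d 0).coprod (a • LinearMap.id)
  | i + 1 => ((P.d (i + 1)).coprod (a • LinearMap.id)).prod
      ((-P.homotopy i).coprod (-P.d i))

lemma mem_range_descentD_sup_iff {i : ℕ} (x : P.X (i + 1)) (y : P.X i) :
    (show P.descentX (i + 1) from (x, y)) ∈
        LinearMap.range (P.descentD (i + 1)) ⊔ (K • ⊤ : Submodule A (P.descentX (i + 1))) ↔
      ∃ z w, x - (P.d (i + 1) z + a • w) ∈ (K • ⊤ : Submodule A (P.X (i + 1))) ∧
        y - (-P.homotopy i z + -P.d i w) ∈ (K • ⊤ : Submodule A (P.X i)) := by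
  refine (LinearMap.mem_range_sup_iff (P.descentD (i + 1)) _ _).trans ?_
  constructor
  · rintro ⟨⟨z, w⟩, h⟩
    exact ⟨z, w, (Submodule.mem_smul_top_prod_iff _ _ _).mp h⟩
  · rintro ⟨z, w, h⟩
    exact ⟨(z, w), (Submodule.mem_smul_top_prod_iff _ _ _).mpr h⟩

/-- A resolution modulo `J ⊔ (a)` yields one modulo `J`, when `a` is a nonzerodivisor
modulo `J`. -/
noncomputable def descent (ha : ∀ q, a * q ∈ J → q ∈ J) : ResolutionMod J M where
  X := P.descentX
  projective
    | 0 => P.projective 0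
    | i + 1 => inferInstanceAs (Module.Projective A (P.X (i + 1) × P.X i))
  d := P.descentD
  ε := P.ε
  surjective_ε := P.surjective_ε
  ker_ε := by
    refine P.ker_ε.trans ?_
    rw [Submodule.sup_smul, Submodule.ideal_span_singleton_smul]
    change _ = LinearMap.range ((P.d 0).coprod (a • LinearMap.id)) ⊔ (J • ⊤ : Submodule A (P.X 0))
    rw [LinearMap.range_coprod, sup_comm (J • ⊤), ← sup_assoc]
    congr 2
    ext x
    simp [Submodule.mem_smul_pointwise_iff_exists]
  comap_d i := by
    ext ⟨x, y⟩
    refine Iff.trans ?_ (P.mem_range_descentD_sup_iff x y).symm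
    cases i with
    | zero =>
      refine ⟨fun h ↦ P.exists_lift_of_mem ha h, ?_⟩
      rintro ⟨z, w, h₁, h₂⟩
      exact P.d_add_smul_mem h₁ h₂
    | succ i =>
      refine ⟨fun h ↦ P.exists_lift_of_mem ha ((Submodule.mem_smul_top_prod_iff _ _ _).mp h).1, ?_⟩
      rintro ⟨z, w, h₁, h₂⟩
      refine (Submodule.mem_smul_top_prod_iff _ _ _).mpr ⟨P.d_add_smul_mem h₁ h₂, ?_⟩
      have h₃ := LinearMap.map_mem_smul_top (P.homotopy i) J h₁
      have h₄ := LinearMap.map_mem_smul_top (P.d i) J h₂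
      simp only [map_sub, map_add, map_smul, map_neg] at h₃ h₄
      change -P.homotopy i x + -P.d i y ∈ _
      convert neg_mem (add_mem (add_mem h₃ h₄) (add_mem (P.homotopy_d_sub_mem ha z)
        (neg_mem (P.d_d_sub_mem w)))) using 1
      module

end Homotopy

section Descent

variable {𝕜 : Type u} [Field 𝕜] [Algebra 𝕜 A] {a : A}
  (P : ResolutionMod (J ⊔ Ideal.span {a}) M)

variable (𝕜) in
lemma restrictRank_homology_zero_le_descent (ha : ∀ q, a * q ∈ J → q ∈ J) (hK : a ∈ K) :
    restrictRank 𝕜 A (P.homology K 0) ≤ restrictRank 𝕜 A ((P.descent ha).homology K 0) := by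
  refine restrictRank_subquotient_le (σ := RingHom.id A) (fun _ ↦ rfl)
    (LinearMap.id : P.X 0 →ₗ[A] P.X 0) (fun _ _ ↦ trivial) ?_ fun y _ ↦ ⟨y, trivial, by simp⟩
  intro x hx
  obtain ⟨⟨z, w⟩, h⟩ := ((P.descent ha).mem_boundaries_iff).mp hx
  refine P.mem_boundaries_iff.mpr ⟨z, ?_⟩
  change x - (P.d 0 z + a • w) ∈ (K • ⊤ : Submodule A (P.X 0)) at h
  have haw : a • (show P.X 0 from w) ∈ (K • ⊤ : Submodule A (P.X 0)) :=
    Submodule.smul_mem_smul hK trivial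
  convert add_mem h haw using 1
  change x - P.d 0 z = _
  module

variable (𝕜) in
lemma restrictRank_homology_le_descent_add (ha : ∀ q, a * q ∈ J → q ∈ J) (hJ : J ≤ K)
    (hK : a ∈ K) (i : ℕ) :
    restrictRank 𝕜 A (P.homology K (i + 2)) ≤
      restrictRank 𝕜 A ((P.descent ha).homology K (i + 2)) +
        restrictRank 𝕜 A (P.homology K i) := by
  have hJK : ∀ {j} {x : P.X j}, x ∈ (J • ⊤ : Submodule A (P.X j)) →
      x ∈ (K • ⊤ : Submodule A (P.X j)) :=
    fun h ↦ Submodule.smul_mono_left hJ h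
  have haK : ∀ {j} (x : P.X j), a • x ∈ (K • ⊤ : Submodule A (P.X j)) :=
    fun x ↦ Submodule.smul_mem_smul hK trivial
  refine restrictRank_subquotient_le_add 𝕜
    (LinearMap.fst A (P.X (i + 2)) (P.X (i + 1))) (P.homotopy i) ?_ ?_ ?_ ?_ ?_
  · rintro ⟨x, y⟩ h
    obtain ⟨h₁, h₂⟩ := (Submodule.mem_smul_top_prod_iff _ _ _).mp h
    change P.d (i + 1) x + a • y ∈ (K • ⊤ : Submodule A (P.X (i + 1))) at h₁
    change P.d (i + 1) x ∈ (K • ⊤ : Submodule A (P.X (i + 1)))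
    simpa using sub_mem h₁ (haK y)
  · rintro ⟨x, y⟩ h
    obtain ⟨z, w, h₁, h₂⟩ := (P.mem_range_descentD_sup_iff x y).mp h
    refine P.mem_boundaries_iff.mpr ⟨z, ?_⟩
    convert add_mem h₁ (haK w) using 1
    change x - P.d _ z = _
    module
  · intro y hy
    cases i with
    | zero => trivial
    | succ i =>
      have h₁ := hJK (P.homotopy_d_sub_mem ha y)
      have h₂ := LinearMap.map_mem_smul_top (P.homotopy i) K hy
      change P.d i (P.homotopy (i + 1) y) ∈ (K • ⊤ : Submodule A _)
      simpa using sub_mem h₂ h₁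
  · intro y hy
    obtain ⟨w, hw⟩ := P.mem_boundaries_iff.mp hy
    refine P.mem_boundaries_iff.mpr ⟨P.homotopy (i + 1) w, ?_⟩
    have h₁ := hJK (P.homotopy_d_sub_mem ha w)
    have h₂ := LinearMap.map_mem_smul_top (P.homotopy i) K hw
    rw [map_sub] at h₂
    simpa using add_mem h₂ h₁
  · intro y hy h
    obtain ⟨w, hw⟩ := P.mem_boundaries_iff.mp h
    refine ⟨(y, -w), (Submodule.mem_smul_top_prod_iff _ _ _).mpr ⟨?_, ?_⟩, ?_⟩
    · exact add_mem hy (haK _)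
    · change -P.homotopy i y + -P.d i (-w) ∈ (K • ⊤ : Submodule A _)
      convert neg_mem hw using 1
      rw [map_neg]
      module
    · change y - y ∈ _
      simp

end Descent

section BaseChange

/-- The canonical map from a module to its base change along a quotient map. -/
def quotientBaseChangeMk (J : Ideal A) (X : Type u) [AddCommGroup X] [Module A X] :
    X →ₛₗ[Ideal.Quotient.mk J] TensorProduct A (A ⧸ J) X where
  toFun x := 1 ⊗ₜ x
  map_add' := TensorProduct.tmul_add _
  map_smul' a x := by
    rw [TensorProduct.tmul_smul, ← Ideal.Quotient.algebraMap_eq, algebraMap_smul]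

lemma quotientBaseChangeMk_surjective (X : Type u) [AddCommGroup X] [Module A X] :
    Function.Surjective (quotientBaseChangeMk J X) :=
  TensorProduct.mk_surjective A X (A ⧸ J) Ideal.Quotient.mk_surjective

lemma quotientBaseChangeMk_eq_zero_iff {X : Type u} [AddCommGroup X] [Module A X] (x : X) :
    quotientBaseChangeMk J X x = 0 ↔ x ∈ (J • ⊤ : Submodule A X) := by
  rw [← (TensorProduct.quotTensorEquivQuotSMul X J).map_eq_zero_iff]
  change TensorProduct.quotTensorEquivQuotSMul X J (Ideal.Quotient.mk J 1 ⊗ₜ x) = 0 ↔ _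
  rw [TensorProduct.quotTensorEquivQuotSMul_mk_tmul, one_smul, Submodule.Quotient.mk_eq_zero]

lemma quotientBaseChangeMk_mem_iff (hJ : J ≤ K) {X : Type u} [AddCommGroup X] [Module A X]
    (x : X) :
    quotientBaseChangeMk J X x ∈
        (K.map (Ideal.Quotient.mk J) • ⊤ : Submodule (A ⧸ J) (TensorProduct A (A ⧸ J) X)) ↔
      x ∈ (K • ⊤ : Submodule A X) := by
  constructor
  · have key : ∀ y ∈ (K.map (Ideal.Quotient.mk J) • ⊤ :
        Submodule (A ⧸ J) (TensorProduct A (A ⧸ J) X)),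
        ∃ z ∈ (K • ⊤ : Submodule A X), quotientBaseChangeMk J X z = y := by
      intro y hy
      induction hy using Submodule.smul_induction_on' with
      | smul r hr n _ =>
        obtain ⟨k, hk, rfl⟩ :=
          (Ideal.mem_map_iff_of_surjective _ Ideal.Quotient.mk_surjective).mp hr
        obtain ⟨z, rfl⟩ := quotientBaseChangeMk_surjective X n
        exact ⟨k • z, Submodule.smul_mem_smul hk trivial, map_smulₛₗ _ _ _⟩
      | add y₁ _ y₂ _ h₁ h₂ =>
        obtain ⟨z₁, hz₁, rfl⟩ := h₁
        obtain ⟨z₂, hz₂, rfl⟩ := h₂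
        exact ⟨z₁ + z₂, add_mem hz₁ hz₂, map_add _ _ _⟩
    intro hx
    obtain ⟨z, hz, h⟩ := key _ hx
    have h' : quotientBaseChangeMk J X (x - z) = 0 := by rw [map_sub, h, sub_self]
    have := add_mem (Submodule.smul_mono_left hJ
      ((quotientBaseChangeMk_eq_zero_iff _).mp h')) hz
    simpa using this
  · intro hx
    induction hx using Submodule.smul_induction_on' with
    | smul k hk n _ =>
      rw [map_smulₛₗ]
      exact Submodule.smul_mem_smul (Ideal.mem_map_of_mem _ hk) trivial
    | add y₁ _ y₂ _ h₁ h₂ =>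
      rw [map_add]
      exact add_mem h₁ h₂

variable (P : ResolutionMod J M) {N : Type u} [AddCommGroup N] [Module (A ⧸ J) N]

/-- The augmentation of the base change. -/
noncomputable def baseChangeε (μ : M →ₛₗ[Ideal.Quotient.mk J] N) :
    TensorProduct A (A ⧸ J) (P.X 0) →ₗ[A ⧸ J] N :=
  letI := Module.compHom N (Ideal.Quotient.mk J)
  haveI : IsScalarTower A (A ⧸ J) N := .of_algebraMap_smul fun _ _ ↦ rfl
  LinearMap.liftBaseChange (A ⧸ J)
    { toFun := fun x ↦ μ (P.ε x)
      map_add' := by simp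
      map_smul' := fun a x ↦ by
        rw [map_smul, map_smulₛₗ]
        rfl }

lemma baseChangeε_mk (μ : M →ₛₗ[Ideal.Quotient.mk J] N) (x : P.X 0) :
    P.baseChangeε μ (quotientBaseChangeMk J _ x) = μ (P.ε x) := by
  change (1 : A ⧸ J) • μ (P.ε x) = _
  rw [one_smul]

/-- A sequence that is a resolution modulo `J` becomes a resolution after base change to the
quotient by `J`. -/
noncomputable def baseChange (μ : M →ₛₗ[Ideal.Quotient.mk J] N) (hμ : Function.Bijective μ) :
    ResolutionMod (⊥ : Ideal (A ⧸ J)) N where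
  X i := ModuleCat.of (A ⧸ J) (TensorProduct A (A ⧸ J) (P.X i))
  projective i := inferInstanceAs (Module.Projective (A ⧸ J) (TensorProduct A (A ⧸ J) (P.X i)))
  d i := (P.d i).baseChange (A ⧸ J)
  ε := P.baseChangeε μ
  surjective_ε n := by
    obtain ⟨m, rfl⟩ := hμ.2 n
    obtain ⟨x, rfl⟩ := P.surjective_ε m
    exact ⟨_, P.baseChangeε_mk μ x⟩
  ker_ε := by
    ext y
    obtain ⟨x, rfl⟩ := quotientBaseChangeMk_surjective _ y
    rw [LinearMap.mem_ker, Submodule.bot_smul, sup_bot_eq]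
    refine (iff_of_eq (congrArg (· = 0) (P.baseChangeε_mk μ x))).trans ?_
    rw [map_eq_zero_iff μ hμ.1, ← LinearMap.mem_ker, P.ker_ε, LinearMap.mem_range_sup_iff]
    constructor
    · rintro ⟨w, hw⟩
      rw [← quotientBaseChangeMk_eq_zero_iff, map_sub, sub_eq_zero] at hw
      exact ⟨quotientBaseChangeMk J _ w, hw.symm⟩
    · rintro ⟨v, hv⟩
      obtain ⟨w, rfl⟩ := quotientBaseChangeMk_surjective _ v
      refine ⟨w, ?_⟩
      rw [← quotientBaseChangeMk_eq_zero_iff, map_sub, sub_eq_zero]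
      exact hv.symm
  comap_d i := by
    ext y
    obtain ⟨x, rfl⟩ := quotientBaseChangeMk_surjective _ y
    rw [Submodule.bot_smul, Submodule.bot_smul, sup_bot_eq, Submodule.mem_comap,
      Submodule.mem_bot]
    refine (quotientBaseChangeMk_eq_zero_iff _).trans ?_
    rw [← Submodule.mem_comap, P.comap_d, LinearMap.mem_range_sup_iff]
    constructor
    · rintro ⟨w, hw⟩
      rw [← quotientBaseChangeMk_eq_zero_iff, map_sub, sub_eq_zero] at hw
      exact ⟨quotientBaseChangeMk J _ w, hw.symm⟩
    · rintro ⟨v, hv⟩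
      obtain ⟨w, rfl⟩ := quotientBaseChangeMk_surjective _ v
      refine ⟨w, ?_⟩
      rw [← quotientBaseChangeMk_eq_zero_iff, map_sub, sub_eq_zero]
      exact hv.symm

variable (μ : M →ₛₗ[Ideal.Quotient.mk J] N) (hμ : Function.Bijective μ)

lemma mk_mem_cycles_baseChange_iff (hJ : J ≤ K) {i : ℕ} (x : P.X i) :
    quotientBaseChangeMk J _ x ∈ (P.baseChange μ hμ).cycles (K.map (Ideal.Quotient.mk J)) i ↔
      x ∈ P.cycles K i := by
  cases i with
  | zero => exact iff_of_true trivial trivial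
  | succ i => exact quotientBaseChangeMk_mem_iff hJ (P.d i x)

lemma mk_mem_boundaries_baseChange_iff (hJ : J ≤ K) {i : ℕ} (x : P.X i) :
    quotientBaseChangeMk J _ x ∈ (P.baseChange μ hμ).boundaries (K.map (Ideal.Quotient.mk J)) i ↔
      x ∈ P.boundaries K i := by
  refine ((P.baseChange μ hμ).mem_boundaries_iff).trans (Iff.trans ?_ P.mem_boundaries_iff.symm)
  constructor
  · rintro ⟨v, hv⟩
    obtain ⟨w, rfl⟩ := quotientBaseChangeMk_surjective _ v
    refine ⟨w, (quotientBaseChangeMk_mem_iff hJ _).mp ?_⟩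
    rw [map_sub]
    exact hv
  · rintro ⟨w, hw⟩
    refine ⟨quotientBaseChangeMk J _ w, ?_⟩
    have h := (quotientBaseChangeMk_mem_iff hJ _).mpr hw
    rw [map_sub] at h
    exact h

variable {𝕜 : Type u} [Field 𝕜] [Algebra 𝕜 A]

variable (𝕜) in
lemma restrictRank_homology_baseChange (hJ : J ≤ K) (i : ℕ) :
    restrictRank 𝕜 (A ⧸ J) ((P.baseChange μ hμ).homology (K.map (Ideal.Quotient.mk J)) i) =
      restrictRank 𝕜 A (P.homology K i) := by
  let π : P.X i →ₛₗ[Ideal.Quotient.mk J] (P.baseChange μ hμ).X i := quotientBaseChangeMk J (P.X i)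
  apply le_antisymm
  · refine restrictRank_subquotient_le (fun _ ↦ rfl) π
      (fun x hx ↦ (P.mk_mem_cycles_baseChange_iff μ hμ hJ x).mpr hx)
      (fun x hx ↦ (P.mk_mem_boundaries_baseChange_iff μ hμ hJ x).mpr hx) fun y hy ↦ ?_
    obtain ⟨x, rfl⟩ := quotientBaseChangeMk_surjective _ y
    exact ⟨x, (P.mk_mem_cycles_baseChange_iff μ hμ hJ x).mp hy, by
      convert Submodule.zero_mem _
      exact sub_self _⟩
  · refine restrictRank_le_of_injective (σ := Ideal.Quotient.mk J) (fun _ ↦ rfl)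
      (Submodule.mapQ ((P.boundaries K i).submoduleOf (P.cycles K i))
        (((P.baseChange μ hμ).boundaries _ i).submoduleOf ((P.baseChange μ hμ).cycles _ i))
        ((π.domRestrict (P.cycles K i)).codRestrict _ fun x ↦
          (P.mk_mem_cycles_baseChange_iff μ hμ hJ x.1).mpr x.2)
        fun x hx ↦ (P.mk_mem_boundaries_baseChange_iff μ hμ hJ x.1).mpr hx)
      ((injective_iff_map_eq_zero _).mpr fun y hy ↦ ?_)
    obtain ⟨x, rfl⟩ := Submodule.mkQ_surjective _ y
    refine (Submodule.Quotient.mk_eq_zero _).mpr ?_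
    exact (P.mk_mem_boundaries_baseChange_iff μ hμ hJ x.1).mp
      ((Submodule.Quotient.mk_eq_zero
        (((P.baseChange μ hμ).boundaries _ i).submoduleOf ((P.baseChange μ hμ).cycles _ i))).mp hy)

end BaseChange

section Tor

lemma bot_d_d (P : ResolutionMod (⊥ : Ideal A) M) {i : ℕ} (x : P.X (i + 2)) :
    P.d i (P.d (i + 1) x) = 0 := by
  have h := P.d_d_mem x
  rwa [Submodule.bot_smul, Submodule.mem_bot] at h

lemma bot_ker_d (P : ResolutionMod (⊥ : Ideal A) M) (i : ℕ) :
    LinearMap.ker (P.d i) = LinearMap.range (P.d (i + 1)) := by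
  have h := P.comap_d i
  rwa [Submodule.bot_smul, Submodule.bot_smul, sup_bot_eq] at h

lemma bot_ker_ε (P : ResolutionMod (⊥ : Ideal A) M) :
    LinearMap.ker P.ε = LinearMap.range (P.d 0) := by
  have h := P.ker_ε
  rwa [Submodule.bot_smul, sup_bot_eq] at h

/-- The chain complex underlying a resolution modulo zero. -/
noncomputable def complex (P : ResolutionMod (⊥ : Ideal A) M) : ChainComplex (ModuleCat.{u} A) ℕ :=
  ChainComplex.of P.X (fun i ↦ ModuleCat.ofHom (P.d i)) fun i ↦ by
    ext x
    exact P.bot_d_d x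

lemma complex_d (P : ResolutionMod (⊥ : Ideal A) M) (i : ℕ) :
    P.complex.d (i + 1) i = ModuleCat.ofHom (P.d i) :=
  ChainComplex.of_d P.X (fun i ↦ ModuleCat.ofHom (P.d i)) i

/-- A resolution modulo zero is a projective resolution. -/
noncomputable def toProjectiveResolution (P : ResolutionMod (⊥ : Ideal A) M) :
    ProjectiveResolution (ModuleCat.of A M) where
  complex := P.complex
  projective n := (IsProjective.iff_projective (P.X n)).mp (P.projective n)
  π := (ChainComplex.toSingle₀Equiv _ _).symm ⟨ModuleCat.ofHom P.ε, by
    rw [P.complex_d]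
    ext x
    exact P.bot_ker_ε.ge ⟨x, rfl⟩⟩
  quasiIso := ⟨fun n ↦ by
    cases n with
    | zero =>
      rw [ChainComplex.quasiIsoAt₀_iff, ShortComplex.quasiIso_iff_of_zeros']
      · have hw : P.complex.d 1 0 ≫ ModuleCat.ofHom P.ε = 0 := by
          rw [P.complex_d]
          ext x
          exact P.bot_ker_ε.ge ⟨x, rfl⟩
        have h : (ShortComplex.mk (P.complex.d 1 0) (ModuleCat.ofHom P.ε) hw).Exact := by
          rw [ShortComplex.moduleCat_exact_iff]
          intro x hx
          obtain ⟨w, hw⟩ := P.bot_ker_ε.le hx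
          exact ⟨w, (congr($(P.complex_d 0).hom w)).trans hw⟩
        refine (ShortComplex.exact_and_epi_g_iff_of_iso ?_).2
          ⟨h, (ModuleCat.epi_iff_surjective _).mpr P.surjective_ε⟩
        exact ShortComplex.isoMk (Iso.refl _) (Iso.refl _) (Iso.refl _)
          ((Category.id_comp _).trans (Category.comp_id _).symm) ((Category.id_comp _).trans
            ((ChainComplex.toSingle₀Equiv_symm_apply_f_zero (C := P.complex)
              (X := ModuleCat.of A M) (ModuleCat.ofHom P.ε) hw).symm.trans
              (Category.comp_id _).symm))
      all_goals rfl
    | succ n =>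
      rw [quasiIsoAt_iff_exactAt']
      · rw [HomologicalComplex.exactAt_iff' _ (n + 1 + 1) (n + 1) n (by simp) (by simp),
          ShortComplex.moduleCat_exact_iff]
        intro x hx
        obtain ⟨w, hw⟩ := (P.bot_ker_d n).le ((congr($(P.complex_d n).hom x)).symm.trans hx)
        exact ⟨w, (congr($(P.complex_d (n + 1)).hom w)).trans hw⟩
      · apply ChainComplex.exactAt_succ_single_obj⟩

lemma restrictRank_shortComplex_homology {𝕜 : Type u} [Field 𝕜] [Algebra 𝕜 A]
    (S : ShortComplex (ModuleCat.{u} A)) {X : Type u} [AddCommGroup X] [Module A X]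
    (Z B : Submodule A X) (ψ : X →ₗ[A] S.X₂) (hψ : Function.Surjective ψ)
    (hZ : ∀ x, x ∈ Z ↔ S.g (ψ x) = 0) (hB : ∀ x, x ∈ B ↔ ∃ w, S.f w = ψ x) :
    restrictRank 𝕜 A S.homology = restrictRank 𝕜 A (Z ⧸ B.submoduleOf Z) := by
  let e : S.homology ≃ₗ[A] LinearMap.ker S.g.hom ⧸ LinearMap.range S.moduleCatToCycles :=
    S.moduleCatHomologyIso.toLinearEquiv
  let q : Z →ₗ[A] LinearMap.ker S.g.hom ⧸ LinearMap.range S.moduleCatToCycles :=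
    Submodule.mkQ _ ∘ₗ ψ.restrict fun x hx ↦ (hZ x).mp hx
  have hq : Function.Surjective q := by
    intro y
    obtain ⟨⟨y, hy⟩, rfl⟩ := Submodule.mkQ_surjective _ y
    obtain ⟨x, rfl⟩ := hψ y
    exact ⟨⟨x, (hZ x).mpr hy⟩, rfl⟩
  have hker : LinearMap.ker q = B.submoduleOf Z := by
    ext x
    refine (Submodule.Quotient.mk_eq_zero (LinearMap.range S.moduleCatToCycles)).trans ?_
    refine Iff.trans ?_ (hB x.1).symm
    exact ⟨fun ⟨w, hw⟩ ↦ ⟨w, congr_arg Subtype.val hw⟩, fun ⟨w, hw⟩ ↦ ⟨w, Subtype.ext hw⟩⟩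
  exact LinearEquiv.restrictRank_eq (e.trans
    ((Submodule.quotEquivOfEq _ _ hker.symm).trans (q.quotKerEquivOfSurjective hq)).symm)

variable (𝕜 : Type u) [Field 𝕜] [Algebra 𝕜 A]

lemma restrictRank_tor (P : ResolutionMod (⊥ : Ideal A) M) (L : Ideal A) (i : ℕ) :
    restrictRank 𝕜 A (((Tor (ModuleCat A) i).obj (ModuleCat.of A (A ⧸ L))).obj
      (ModuleCat.of A M)) = restrictRank 𝕜 A (P.homology L i) := by
  let F := (MonoidalCategory.tensoringLeft (ModuleCat.{u} A)).obj (ModuleCat.of A (A ⧸ L))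
  let C := (F.mapHomologicalComplex (ComplexShape.down ℕ)).obj P.complex
  let ψ (i : ℕ) : P.X i →ₗ[A] TensorProduct A (A ⧸ L) (P.X i) :=
    TensorProduct.mk A (A ⧸ L) (P.X i) 1
  have hψ (i : ℕ) : Function.Surjective (ψ i) := quotientBaseChangeMk_surjective (J := L) (P.X i)
  have hψ₀ {i : ℕ} (x : P.X i) : ψ i x = 0 ↔ x ∈ (L • ⊤ : Submodule A (P.X i)) :=
    quotientBaseChangeMk_eq_zero_iff (J := L) x
  have hd {i : ℕ} (x : P.X (i + 1)) : C.d (i + 1) i (ψ (i + 1) x) = ψ i (P.d i x) := by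
    change F.map (P.complex.d (i + 1) i) (ψ (i + 1) x) = _
    rw [P.complex_d]
    rfl
  have hB {i : ℕ} (x : P.X i) : x ∈ P.boundaries L i ↔ ∃ w, C.d (i + 1) i w = ψ i x := by
    refine P.mem_boundaries_iff.trans ⟨?_, ?_⟩
    · rintro ⟨w, hw⟩
      rw [← hψ₀, map_sub, sub_eq_zero] at hw
      exact ⟨ψ _ w, (hd w).trans hw.symm⟩
    · rintro ⟨v, hv⟩
      obtain ⟨w, rfl⟩ := hψ _ v
      refine ⟨w, ?_⟩
      rw [← hψ₀, map_sub, sub_eq_zero]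
      exact hv.symm.trans (hd w)
  refine (LinearEquiv.restrictRank_eq
    (P.toProjectiveResolution.isoLeftDerivedObj F i).toLinearEquiv).trans ?_
  change restrictRank 𝕜 A (C.homology i) = _
  cases i with
  | zero =>
    refine (LinearEquiv.restrictRank_eq
      (C.homologyIsoSc' 1 0 0 (by simp) (by simp)).toLinearEquiv).trans ?_
    refine restrictRank_shortComplex_homology _ _ _ (ψ 0) (hψ 0) (fun x ↦ ?_) hB
    refine iff_of_true trivial ?_
    change C.d 0 0 (ψ 0 x) = 0
    rw [C.shape 0 0 (by simp)]
    rfl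
  | succ i =>
    refine (LinearEquiv.restrictRank_eq
      (C.homologyIsoSc' (i + 2) (i + 1) i (by simp) (by simp)).toLinearEquiv).trans ?_
    refine restrictRank_shortComplex_homology _ _ _ (ψ (i + 1)) (hψ (i + 1)) (fun x ↦ ?_) hB
    refine (hψ₀ (P.d i x)).symm.trans ?_
    rw [← hd]
    rfl

end Tor

section Free

variable (J M) in
/-- The modules of the free resolution modulo `J`, with their submodules of cycles. -/
noncomputable def freeStage : ℕ → Σ X : ModuleCat.{u} A, Submodule A X
  | 0 => ⟨ModuleCat.of A (M →₀ A), LinearMap.ker (Finsupp.linearCombination A id)⟩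
  | i + 1 => ⟨ModuleCat.of A ((freeStage i).2 →₀ A), (J • ⊤ : Submodule A (freeStage i).1).comap
      (Finsupp.linearCombination A Subtype.val)⟩

lemma eq_range_linearCombination_sup {X : Type u} [AddCommGroup X] [Module A X]
    {N N' : Submodule A X} (h : N' ≤ N) :
    N = LinearMap.range (Finsupp.linearCombination A (Subtype.val : N → X)) ⊔ N' := by
  rw [Finsupp.range_linearCombination, Subtype.range_coe, Submodule.span_eq, sup_eq_left.mpr h]

variable (J M) in
/-- The free resolution modulo `J` of a module annihilated by `J`. -/
noncomputable def free (hM : ∀ j ∈ J, ∀ x : M, j • x = 0) : ResolutionMod J M where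
  X i := (freeStage J M i).1
  projective i := by
    cases i with
    | zero => exact inferInstanceAs (Module.Projective A (M →₀ A))
    | succ i => exact inferInstanceAs (Module.Projective A ((freeStage J M i).2 →₀ A))
  d i := Finsupp.linearCombination A (Subtype.val : (freeStage J M i).2 → (freeStage J M i).1)
  ε := Finsupp.linearCombination A id
  surjective_ε x := ⟨Finsupp.single x 1, (Finsupp.linearCombination_single A 1 x).trans
    (one_smul A x)⟩
  ker_ε := eq_range_linearCombination_sup <| Submodule.smul_le.mpr fun j hj x _ ↦
    (map_smul (Finsupp.linearCombination A id) j x).trans (hM j hj _)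
  comap_d _ := eq_range_linearCombination_sup (Submodule.smul_top_le_comap_smul_top J
    (Finsupp.linearCombination A Subtype.val))

end Free

section Cone

variable {M₁ M₂ M₃ : Type u} [AddCommGroup M₁] [Module A M₁] [AddCommGroup M₂] [Module A M₂]
  [AddCommGroup M₃] [Module A M₃] (P : ResolutionMod (⊥ : Ideal A) M₁)
  (T : ResolutionMod (⊥ : Ideal A) M₂) (f : M₁ →ₗ[A] M₂)

lemma exists_lift_zero : ∃ φ : P.X 0 →ₗ[A] T.X 0, ∀ x, T.ε (φ x) = f (P.ε x) :=
  Module.Projective.exists_lift T.ε (f ∘ₗ P.ε) fun _ ↦ T.surjective_ε _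

lemma exists_lift_succ {i : ℕ} {φ : P.X i →ₗ[A] T.X i}
    (hφ : ∀ x, φ (P.d i x) ∈ LinearMap.range (T.d i)) :
    ∃ φ' : P.X (i + 1) →ₗ[A] T.X (i + 1), ∀ x, T.d i (φ' x) = φ (P.d i x) :=
  Module.Projective.exists_lift (T.d i) (φ ∘ₗ P.d i) hφ

/-- The components of a chain map lifting `f`, together with the condition that allows the
next component to be constructed. -/
noncomputable def liftAux : ∀ i,
    {φ : P.X i →ₗ[A] T.X i // ∀ x, φ (P.d i x) ∈ LinearMap.range (T.d i)}
  | 0 => ⟨(P.exists_lift_zero T f).choose, fun x ↦ by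
      rw [← T.bot_ker_ε, LinearMap.mem_ker, (P.exists_lift_zero T f).choose_spec,
        LinearMap.mem_ker.mp (P.bot_ker_ε.ge ⟨x, rfl⟩), map_zero]⟩
  | i + 1 => ⟨(P.exists_lift_succ T (liftAux i).2).choose, fun x ↦ by
      rw [← T.bot_ker_d, LinearMap.mem_ker, (P.exists_lift_succ T (liftAux i).2).choose_spec,
        P.bot_d_d, map_zero]⟩

/-- The components of a chain map lifting `f`. -/
noncomputable def lift (i : ℕ) : P.X i →ₗ[A] T.X i := (P.liftAux T f i).1

lemma ε_lift (x : P.X 0) : T.ε (P.lift T f 0 x) = f (P.ε x) :=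
  (P.exists_lift_zero T f).choose_spec x

lemma d_lift {i : ℕ} (x : P.X (i + 1)) :
    T.d i (P.lift T f (i + 1) x) = P.lift T f i (P.d i x) :=
  (P.exists_lift_succ T (P.liftAux T f i).2).choose_spec x

/-- The modules of the mapping cone. -/
def coneX : ℕ → ModuleCat.{u} A
  | 0 => T.X 0
  | i + 1 => ModuleCat.of A (T.X (i + 1) × P.X i)

/-- The maps of the mapping cone. -/
noncomputable def coneD : ∀ i, P.coneX T (i + 1) →ₗ[A] P.coneX T i
  | 0 => (T.d 0).coprod (P.lift T f 0)
  | i + 1 => ((T.d (i + 1)).coprod (P.lift T f (i + 1))).prod (-(P.d i ∘ₗ LinearMap.snd A _ _))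

lemma mem_range_coneD_iff {i : ℕ} (x : T.X (i + 1)) (y : P.X i) :
    (x, y) ∈ LinearMap.range (P.coneD T f (i + 1)) ↔
      ∃ v w, T.d (i + 1) v + P.lift T f (i + 1) w = x ∧ -P.d i w = y := by
  constructor
  · rintro ⟨⟨v, w⟩, h⟩
    exact ⟨v, w, congr_arg Prod.fst h, congr_arg Prod.snd h⟩
  · rintro ⟨v, w, h₁, h₂⟩
    exact ⟨(v, w), Prod.ext h₁ h₂⟩

lemma mem_range_coneD_of_d_add_lift_eq_zero {i : ℕ} {x : T.X (i + 1)} {y : P.X i}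
    (h : T.d i x + P.lift T f i y = 0) (hy : y ∈ LinearMap.range (P.d i)) :
    (x, y) ∈ LinearMap.range (P.coneD T f (i + 1)) := by
  obtain ⟨w, rfl⟩ := hy
  rw [← P.d_lift, ← map_add] at h
  obtain ⟨v, hv⟩ := (T.bot_ker_d i).le h
  refine (P.mem_range_coneD_iff T f _ _).mpr ⟨v, -w, ?_, ?_⟩
  · rw [hv, map_neg, add_neg_cancel_right]
  · rw [map_neg, neg_neg]

lemma coneD_coneD {i : ℕ} (x : P.coneX T (i + 2)) :
    P.coneD T f i (P.coneD T f (i + 1) x) = 0 := by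
  obtain ⟨v, w⟩ := x
  cases i with
  | zero =>
    change T.d 0 (T.d 1 v + P.lift T f 1 w) + P.lift T f 0 (-P.d 0 w) = 0
    rw [map_add, T.bot_d_d, P.d_lift, map_neg, zero_add, add_neg_cancel]
  | succ i =>
    refine Prod.ext (?_ : T.d (i + 1) (T.d (i + 2) v + P.lift T f (i + 2) w) +
      P.lift T f (i + 1) (-P.d (i + 1) w) = 0) (?_ : -P.d i (-P.d (i + 1) w) = 0)
    · rw [map_add, T.bot_d_d, P.d_lift, map_neg, zero_add, add_neg_cancel]
    · rw [map_neg, P.bot_d_d, neg_zero, neg_zero]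

/-- The mapping cone of a chain map lifting an injective map resolves the cokernel. -/
noncomputable def cone (g : M₂ →ₗ[A] M₃) (hf : Function.Injective f) (hg : Function.Surjective g)
    (hfg : LinearMap.ker g = LinearMap.range f) : ResolutionMod (⊥ : Ideal A) M₃ where
  X := P.coneX T
  projective i := by
    cases i with
    | zero => exact T.projective 0
    | succ i => exact inferInstanceAs (Module.Projective A (T.X (i + 1) × P.X i))
  d := P.coneD T f
  ε := g ∘ₗ T.ε
  surjective_ε := hg.comp T.surjective_ε
  ker_ε := by
    rw [Submodule.bot_smul, sup_bot_eq]
    apply le_antisymm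
    · intro (x : T.X 0) (hx : g (T.ε x) = 0)
      obtain ⟨m, hm⟩ := hfg.le hx
      obtain ⟨y, rfl⟩ := P.surjective_ε m
      have h : x - P.lift T f 0 y ∈ LinearMap.ker T.ε := by
        rw [LinearMap.mem_ker, map_sub, P.ε_lift, hm, sub_self]
      obtain ⟨v, hv⟩ := T.bot_ker_ε.le h
      exact ⟨(v, y), eq_sub_iff_add_eq.mp hv⟩
    · rintro _ ⟨⟨v, y⟩, rfl⟩
      change g (T.ε (T.d 0 v + P.lift T f 0 y)) = 0
      rw [map_add, LinearMap.mem_ker.mp (T.bot_ker_ε.ge ⟨v, rfl⟩), P.ε_lift, zero_add]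
      exact hfg.ge ⟨_, rfl⟩
  comap_d i := by
    rw [Submodule.bot_smul, Submodule.bot_smul, sup_bot_eq]
    apply le_antisymm
    · rintro ⟨x, y⟩ hxy
      cases i with
      | zero =>
        have h : T.d 0 x + P.lift T f 0 y = 0 := hxy
        refine P.mem_range_coneD_of_d_add_lift_eq_zero T f h (P.bot_ker_ε.le (hf ?_))
        rw [map_zero, ← P.ε_lift, eq_neg_of_add_eq_zero_right h, map_neg,
          LinearMap.mem_ker.mp (T.bot_ker_ε.ge ⟨x, rfl⟩), neg_zero]
      | succ i =>
        have h : T.d (i + 1) x + P.lift T f (i + 1) y = 0 := congr_arg Prod.fst hxy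
        have h' : -P.d i y = 0 := congr_arg Prod.snd hxy
        exact P.mem_range_coneD_of_d_add_lift_eq_zero T f h
          ((P.bot_ker_d i).le (neg_eq_zero.mp h'))
    · rintro _ ⟨x, rfl⟩
      exact P.coneD_coneD T f x

end Cone

section Monomial

variable {𝕜 : Type u} {σ : Type} [Field 𝕜]

open MvPolynomial

lemma _root_.MvPolynomial.mem_span_range_monomial_iff {R τ ι : Type*} [CommRing R]
    (v : ι → τ →₀ ℕ) (q : MvPolynomial τ R) :
    q ∈ Ideal.span (Set.range fun j ↦ monomial (v j) (1 : R)) ↔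
      ∀ e, coeff e q ≠ 0 → ∃ j, v j ≤ e := by
  have h := mem_ideal_span_monomial_image (x := q) (s := Set.range v)
  rw [← Set.range_comp] at h
  refine h.trans ?_
  simp

lemma _root_.MvPolynomial.monomial_mul_mem_span_range_monomial_iff {R τ ι : Type*} [CommRing R]
    (v : ι → τ →₀ ℕ) (w : τ →₀ ℕ) (q : MvPolynomial τ R) :
    monomial w 1 * q ∈ Ideal.span (Set.range fun j ↦ monomial (v j) (1 : R)) ↔
      q ∈ Ideal.span (Set.range fun j ↦ monomial (v j - w) (1 : R)) := by
  rw [mem_span_range_monomial_iff, mem_span_range_monomial_iff]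
  constructor
  · intro h e he
    obtain ⟨j, hj⟩ := h (w + e) (by rwa [coeff_monomial_mul, one_mul])
    exact ⟨j, tsub_le_iff_left.mpr hj⟩
  · intro h e he
    rw [coeff_monomial_mul', one_mul, ite_ne_right_iff] at he
    obtain ⟨j, hj⟩ := h _ he.2
    exact ⟨j, by simpa [he.1] using tsub_le_iff_left.mp hj⟩

/-- The resolution of a ring modulo the zero ideal. -/
noncomputable def trivialResolution (I : Ideal A) (hI : I = ⊥) :
    ResolutionMod (⊥ : Ideal A) (A ⧸ I) where
  X i := ModuleCat.of A (Fin (Nat.choose 0 i) → A)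
  projective i := inferInstanceAs (Module.Projective A (Fin (Nat.choose 0 i) → A))
  d _ := 0
  ε := I.mkQ ∘ₗ LinearMap.proj (0 : Fin 1)
  surjective_ε := I.mkQ_surjective.comp fun x ↦ ⟨fun _ ↦ x, rfl⟩
  ker_ε := by
    rw [Submodule.bot_smul, sup_bot_eq, LinearMap.range_zero, Submodule.eq_bot_iff]
    intro x hx
    have h : x (0 : Fin 1) ∈ I := (Submodule.Quotient.mk_eq_zero _).mp hx
    rw [hI, Submodule.mem_bot] at h
    exact funext fun i : Fin 1 ↦ by rwa [Subsingleton.elim i 0]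
  comap_d i := by
    ext x
    obtain rfl : x = 0 := funext fun j : Fin 0 ↦ j.elim0
    exact iff_of_true (zero_mem _) (zero_mem _)

theorem exists_basis_resolution_monomial (r : ℕ) (v : Fin r → σ →₀ ℕ) :
    ∃ T : ResolutionMod (⊥ : Ideal (MvPolynomial σ 𝕜))
      (MvPolynomial σ 𝕜 ⧸ Ideal.span (Set.range fun j ↦ monomial (v j) (1 : 𝕜))),
      ∀ i, Nonempty (Module.Basis (Fin (r.choose i)) (MvPolynomial σ 𝕜) (T.X i)) := by
  induction r with
  | zero => exact ⟨trivialResolution _ (by simp), fun i ↦ ⟨Pi.basisFun _ _⟩⟩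
  | succ r ih =>
    set I := Ideal.span (Set.range fun j ↦ monomial (v j) (1 : 𝕜)) with hI
    set I₁ := Ideal.span (Set.range fun j : Fin r ↦ monomial (v j.succ - v 0) (1 : 𝕜))
    set I₂ := Ideal.span (Set.range fun j : Fin r ↦ monomial (v j.succ) (1 : 𝕜)) with hI₂
    obtain ⟨P, hP⟩ := ih fun j ↦ v j.succ - v 0
    obtain ⟨T, hT⟩ := ih fun j ↦ v j.succ
    let m : MvPolynomial σ 𝕜 := monomial (v 0) 1
    have hsup : I = I₂ ⊔ Ideal.span {m} := by
      rw [hI, hI₂, ← Ideal.span_union, Set.union_comm, Set.singleton_union, Fin.range_fin_succ]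
      rfl
    have hm (q) : m * q ∈ I₂ ↔ q ∈ I₁ :=
      monomial_mul_mem_span_range_monomial_iff (fun j : Fin r ↦ v j.succ) (v 0) q
    let f : (MvPolynomial σ 𝕜 ⧸ I₁) →ₗ[MvPolynomial σ 𝕜] MvPolynomial σ 𝕜 ⧸ I₂ :=
      Submodule.mapQ I₁ I₂ (LinearMap.mulLeft _ m) fun q ↦ (hm q).mpr
    let g : (MvPolynomial σ 𝕜 ⧸ I₂) →ₗ[MvPolynomial σ 𝕜] MvPolynomial σ 𝕜 ⧸ I :=
      Submodule.factor (hsup ▸ le_sup_left)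
    refine ⟨P.cone T f g ?_ (Submodule.factor_surjective _) ?_, fun i ↦ ?_⟩
    · refine (injective_iff_map_eq_zero _).mpr fun y hy ↦ ?_
      obtain ⟨q, rfl⟩ := I₁.mkQ_surjective y
      exact (Submodule.Quotient.mk_eq_zero _).mpr
        ((hm q).mp ((Submodule.Quotient.mk_eq_zero I₂).mp hy))
    · ext y
      obtain ⟨q, rfl⟩ := I₂.mkQ_surjective y
      refine (Submodule.Quotient.mk_eq_zero I).trans ?_
      change q ∈ I ↔ _
      rw [hsup, sup_comm, Ideal.mem_span_singleton_sup]
      constructor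
      · rintro ⟨s, b, hb, h⟩
        refine ⟨I₁.mkQ s, (Submodule.Quotient.eq I₂).mpr ?_⟩
        have : LinearMap.mulLeft (MvPolynomial σ 𝕜) m s - q = -b := by
          rw [← h, LinearMap.mulLeft_apply]
          ring
        rw [this]
        exact neg_mem hb
      · rintro ⟨y, hy⟩
        obtain ⟨s, rfl⟩ := I₁.mkQ_surjective y
        refine ⟨s, q - m * s, ?_, by ring⟩
        exact (Submodule.Quotient.eq I₂).mp hy.symm
    · cases i with
      | zero => exact (hT 0).map fun b ↦
          b.reindex (finCongr ((r.choose_zero_right).trans (r + 1).choose_zero_right.symm))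
      | succ i =>
        obtain ⟨b₁⟩ := hT (i + 1)
        obtain ⟨b₂⟩ := hP i
        exact ⟨(b₁.prod b₂).reindex (finSumFinEquiv.trans
          (finCongr ((add_comm _ _).trans (Nat.choose_succ_succ r i).symm)))⟩

end Monomial

section Bounds

variable {𝕜 : Type u} [Field 𝕜] [Algebra 𝕜 A]

variable (𝕜) in
lemma restrictRank_homology_le_of_basis (P : ResolutionMod J M)
    (hK : ∀ a : A, ∃ c : 𝕜, a - algebraMap 𝕜 A c ∈ K) {i k : ℕ}
    (b : Module.Basis (Fin k) A (P.X i)) : restrictRank 𝕜 A (P.homology K i) ≤ k := by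
  let B := P.boundaries K i
  let s : (Fin k → 𝕜) →ₛₗ[algebraMap 𝕜 A] P.X i ⧸ B :=
    { toFun := fun c ↦ B.mkQ (∑ j, algebraMap 𝕜 A (c j) • b j)
      map_add' := fun c c' ↦ by
        simp only [Pi.add_apply, map_add, add_smul, Finset.sum_add_distrib]
      map_smul' := fun c c' ↦ by simp [mul_smul, Finset.smul_sum] }
  have hs : Function.Surjective s := by
    intro y
    obtain ⟨x, rfl⟩ := B.mkQ_surjective y
    choose c hc using fun j ↦ hK (b.repr x j)
    refine ⟨c, ((Submodule.Quotient.eq B).mpr ?_).symm⟩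
    refine Submodule.mem_sup_right ?_
    rw [← b.sum_repr x, ← Finset.sum_sub_distrib]
    refine Submodule.sum_mem _ fun j _ ↦ ?_
    rw [← sub_smul]
    exact Submodule.smul_mem_smul (hc j) trivial
  have h₁ : restrictRank 𝕜 A (P.homology K i) ≤ restrictRank 𝕜 A (P.X i ⧸ B) := by
    refine restrictRank_le_of_injective (σ := RingHom.id A) (fun _ ↦ rfl)
      (Submodule.mapQ (B.submoduleOf (P.cycles K i)) B (P.cycles K i).subtype le_rfl)
      ((injective_iff_map_eq_zero _).mpr fun y hy ↦ ?_)
    obtain ⟨x, rfl⟩ := Submodule.mkQ_surjective _ y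
    exact (Submodule.Quotient.mk_eq_zero _).mpr ((Submodule.Quotient.mk_eq_zero B).mp hy)
  have h₂ : restrictRank 𝕜 A (P.X i ⧸ B) ≤ restrictRank 𝕜 𝕜 (Fin k → 𝕜) :=
    restrictRank_le_of_surjective (fun _ ↦ rfl) s hs
  have h₃ : restrictRank 𝕜 𝕜 (Fin k → 𝕜) = k := rank_fin_fun k
  exact h₁.trans (h₂.trans h₃.le)

theorem restrictRank_homology_even_le (b : ℕ → ℕ)
    (hb : ∀ (P : ResolutionMod (⊥ : Ideal A) M) m, restrictRank 𝕜 A (P.homology K (2 * m)) ≤ b m)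
    (l : List A) (hl : RingTheory.Sequence.IsWeaklyRegular A l) (hlK : ∀ a ∈ l, a ∈ K)
    (hJ : J = Ideal.ofList l) (P : ResolutionMod J M) (m : ℕ) :
    restrictRank 𝕜 A (P.homology K (2 * m)) ≤
      (∑ j ∈ Finset.range (m + 1), b j * Nat.multichoose l.length (m - j) : ℕ) := by
  induction l using List.reverseRecOn generalizing J m with
  | nil =>
    obtain rfl : J = ⊥ := by rw [hJ, Ideal.ofList_nil]
    refine (hb P m).trans (Nat.cast_le.mpr ?_)
    have h := Finset.single_le_sum (f := fun j ↦ b j * Nat.multichoose 0 (m - j))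
      (fun _ _ ↦ Nat.zero_le _) (Finset.self_mem_range_succ m)
    simpa using h
  | append_singleton l a ih =>
    rw [RingTheory.Sequence.isWeaklyRegular_append_iff,
      RingTheory.Sequence.isWeaklyRegular_singleton_iff,
      isSMulRegular_quotient_iff_mem_of_smul_mem, smul_eq_mul, Ideal.mul_top] at hl
    rw [Ideal.ofList_append, Ideal.ofList_singleton] at hJ
    subst hJ
    have hlK' : ∀ a ∈ l, a ∈ K := fun a ha ↦ hlK a (List.mem_append_left _ ha)
    have haK : a ∈ K := hlK a (by simp)
    have ih' := ih hl.1 hlK' rfl (P.descent hl.2)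
    rw [List.length_append, List.length_singleton]
    induction m with
    | zero =>
      refine (P.restrictRank_homology_zero_le_descent 𝕜 hl.2 haK).trans ((ih' 0).trans ?_)
      simp
    | succ m ihm =>
      refine (P.restrictRank_homology_le_descent_add 𝕜 hl.2 (Ideal.span_le.mpr hlK') haK _).trans
        ((add_le_add (ih' (m + 1)) ihm).trans ?_)
      rw [← Nat.cast_add, Nat.cast_le, Finset.sum_range_succ _ (m + 1),
        Finset.sum_range_succ _ (m + 1), add_right_comm, ← Finset.sum_add_distrib]
      refine add_le_add (Finset.sum_le_sum fun j hj ↦ ?_) (by simp)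
      rw [Nat.succ_sub (Finset.mem_range_succ_iff.mp hj), Nat.multichoose_succ_succ, mul_add]

lemma _root_.Nat.multichoose_le_choose_pred (c k : ℕ) :
    Nat.multichoose c k ≤ (c + k - 1).choose (c - 1) := by
  cases c with
  | zero => cases k <;> simp
  | succ c => rw [Nat.multichoose_eq, Nat.add_right_comm, Nat.add_sub_cancel, Nat.add_sub_cancel,
      Nat.choose_symm_add]

end Bounds

section Quotient

variable {I : Ideal A}

/-- The map from `A / I` to the quotient of `A / J` by the extension of `I`. -/
noncomputable def quotientMap (I J : Ideal A) :
    (A ⧸ I) →ₛₗ[Ideal.Quotient.mk J] (A ⧸ J) ⧸ I.map (Ideal.Quotient.mk J) :=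
  Submodule.mapQ I (I.map (Ideal.Quotient.mk J)) (RingHom.toSemilinearMap (Ideal.Quotient.mk J))
    fun _ hx ↦ Ideal.mem_map_of_mem _ hx

lemma bijective_quotientMap (h : J ≤ I) : Function.Bijective (quotientMap I J) := by
  constructor
  · refine (injective_iff_map_eq_zero _).mpr fun y hy ↦ ?_
    obtain ⟨q, rfl⟩ := I.mkQ_surjective y
    have hq : Ideal.Quotient.mk J q ∈ I.map (Ideal.Quotient.mk J) :=
      (Submodule.Quotient.mk_eq_zero _).mp hy
    rw [← Ideal.mem_comap, Ideal.comap_map_quotientMk, sup_eq_right.mpr h] at hq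
    exact (Submodule.Quotient.mk_eq_zero I).mpr hq
  · intro y
    obtain ⟨y, rfl⟩ := Submodule.mkQ_surjective _ y
    obtain ⟨q, rfl⟩ := Ideal.Quotient.mk_surjective y
    exact ⟨I.mkQ q, rfl⟩

theorem restrictRank_tor_quotient_even_le {𝕜 : Type u} [Field 𝕜] [Algebra 𝕜 A] (b : ℕ → ℕ)
    (hb : ∀ (P : ResolutionMod (⊥ : Ideal A) (A ⧸ I)) m,
      restrictRank 𝕜 A (P.homology K (2 * m)) ≤ b m)
    (l : List A) (hl : RingTheory.Sequence.IsWeaklyRegular A l) (hlK : ∀ a ∈ l, a ∈ K)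
    (hlI : ∀ a ∈ l, a ∈ I) (hJ : J = Ideal.ofList l) (m : ℕ) :
    restrictRank 𝕜 (A ⧸ J) (((Tor (ModuleCat (A ⧸ J)) (2 * m)).obj
      (ModuleCat.of _ ((A ⧸ J) ⧸ K.map (Ideal.Quotient.mk J)))).obj
        (ModuleCat.of _ ((A ⧸ J) ⧸ I.map (Ideal.Quotient.mk J)))) ≤
      (∑ j ∈ Finset.range (m + 1), b j * Nat.multichoose l.length (m - j) : ℕ) := by
  have hJI : J ≤ I := hJ.trans_le (Ideal.span_le.mpr hlI)
  have hJK : J ≤ K := hJ.trans_le (Ideal.span_le.mpr hlK)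
  let P := free J (A ⧸ I) fun j hj x ↦ by
    obtain ⟨q, rfl⟩ := I.mkQ_surjective x
    exact (Submodule.Quotient.mk_eq_zero I).mpr (I.mul_mem_right q (hJI hj))
  rw [restrictRank_tor 𝕜 (P.baseChange (quotientMap I J) (bijective_quotientMap hJI)),
    restrictRank_homology_baseChange P _ _ 𝕜 hJK]
  exact restrictRank_homology_even_le b hb l hl hlK hJ P m

end Quotient

lemma _root_.MvPolynomial.mem_span_range_X_iff {R τ : Type*} [CommRing R]
    (q : MvPolynomial τ R) :
    q ∈ Ideal.span (Set.range (MvPolynomial.X : τ → MvPolynomial τ R)) ↔ constantCoeff q = 0 := by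
  rw [constantCoeff_eq]
  refine (mem_span_range_monomial_iff (fun i : τ ↦ Finsupp.single i 1) q).trans ?_
  constructor
  · intro h
    by_contra h₀
    obtain ⟨j, hj⟩ := h 0 h₀
    exact one_ne_zero (α := ℕ) (by simpa using hj j)
  · intro h e he
    obtain ⟨i, hi⟩ := Finsupp.ne_iff.mp fun h₀ : e = 0 ↦ he (h₀ ▸ h)
    exact ⟨i, Finsupp.single_le_iff.mpr (Nat.one_le_iff_ne_zero.mpr hi)⟩

end ResolutionMod

/-- Let `I = ⟨m₁,…,m_r⟩` be a monomial ideal in `Q = 𝕜[x₁,…,xₙ]` (with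
`m_j = x^{v j}`), let `a₁,…,a_c` be a regular sequence of homogeneous polynomials of positive
degree contained in `I`, and let `R = Q/⟨a₁,…,a_c⟩` with graded maximal ideal `𝔪_R`. Then for
every `m ≥ 0` the even total Betti numbers of `R/I` over `R` satisfy
`β_{2m}(R/I) = dim_𝕜 Tor^R_{2m}(R/𝔪_R, R/IR) ≤ Σ_{j=0}^{m} C(r,2j)·C(c+m−j−1, c−1)`. -/
theorem even_betti_bound {𝕜 : Type*} [Field 𝕜] {n r c : ℕ}
    (v : Fin r → (Fin n →₀ ℕ)) (a : Fin c → MvPolynomial (Fin n) 𝕜)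
    (hreg : RingTheory.Sequence.IsRegular (MvPolynomial (Fin n) 𝕜) (List.ofFn a))
    (hhom : ∀ i, ∃ d : ℕ, 0 < d ∧ (a i).IsHomogeneous d)
    (hmem : ∀ i, a i ∈ Ideal.span (Set.range fun j => monomial (v j) (1 : 𝕜))) :
    ∀ m : ℕ,
      Module.rank 𝕜
        (RestrictScalars 𝕜 (CIRing 𝕜 n c a)
          (((Tor (ModuleCat (CIRing 𝕜 n c a)) (2 * m)).obj
              (ModuleCat.of _ (CIRing 𝕜 n c a ⧸ gradedMaxIdeal 𝕜 n c a))).obj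
            (ModuleCat.of _ (CIRing 𝕜 n c a ⧸ extIdeal 𝕜 c v a)))) ≤
      ((∑ j ∈ Finset.range (m + 1),
        Nat.choose r (2 * j) * Nat.choose (c + m - j - 1) (c - 1) : ℕ) : Cardinal) := by
  intro m
  let I := Ideal.span (Set.range fun j ↦ monomial (v j) (1 : 𝕜))
  let K := Ideal.span (Set.range (X : Fin n → MvPolynomial (Fin n) 𝕜))
  have hK (q : MvPolynomial (Fin n) 𝕜) : ∃ t : 𝕜, q - algebraMap 𝕜 _ t ∈ K :=
    ⟨constantCoeff q, (mem_span_range_X_iff _).mpr (by simp [algebraMap_eq])⟩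
  have haK : ∀ i, a i ∈ K := fun i ↦ by
    obtain ⟨d, hd, h⟩ := hhom i
    rw [mem_span_range_X_iff, constantCoeff_eq]
    exact h.coeff_eq_zero (by simpa using hd.ne)
  have hb (P : ResolutionMod ⊥ (MvPolynomial (Fin n) 𝕜 ⧸ I)) (j : ℕ) :
      restrictRank 𝕜 (MvPolynomial (Fin n) 𝕜) (P.homology K (2 * j)) ≤ (r.choose (2 * j) : ℕ) := by
    obtain ⟨T, hT⟩ := ResolutionMod.exists_basis_resolution_monomial (𝕜 := 𝕜) r v
    obtain ⟨b⟩ := hT (2 * j)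
    rw [← P.restrictRank_tor 𝕜, T.restrictRank_tor 𝕜]
    exact T.restrictRank_homology_le_of_basis 𝕜 hK b
  have hmax : gradedMaxIdeal 𝕜 n c a = K.map (Ideal.Quotient.mk (Ideal.span (Set.range a))) := by
    rw [Ideal.map_span, ← Set.range_comp]
    rfl
  have h := ResolutionMod.restrictRank_tor_quotient_even_le (𝕜 := 𝕜) (I := I) (K := K)
    (J := Ideal.span (Set.range a)) _ hb (List.ofFn a) hreg.toIsWeaklyRegular
    (List.forall_mem_ofFn_iff.mpr haK) (List.forall_mem_ofFn_iff.mpr hmem)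
    (congr_arg Ideal.span (by ext; simp [List.mem_ofFn'])) m
  rw [hmax]
  refine le_trans h (Nat.cast_le.mpr (Finset.sum_le_sum fun j hj ↦ Nat.mul_le_mul_left _ ?_))
  rw [List.length_ofFn, Nat.add_sub_assoc (Finset.mem_range_succ_iff.mp hj)]
  exact Nat.multichoose_le_choose_pred c (m - j)
end

section
/- Let I = ⟨m₁,…,m_r⟩ be a monomial ideal in Q = 𝕜[x₁,…,xₙ], let a₁,…,a_c be a regular sequence of homogeneous polynomials of positive degree contained in I, and set R = Q/⟨a₁,…,a_c⟩ with graded maximal ideal 𝔪_R = (x₁,…,xₙ)R. Then for every m ≥ 0, the odd total Betti numbers of R/I over R satisfy β_{2m+1}(R/I) = dim_𝕜 Tor_{2m+1}^R(R/𝔪_R, R/IR) ≤ Σ_{j=0}^{m} C(r, 2j+1) · C(c + m − j − 1, c − 1). -/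
open MvPolynomial CategoryTheory

set_option synthInstance.maxHeartbeats 1000000
set_option maxHeartbeats 1000000

universe u

section FreeRes

open scoped Pointwise

variable {Q : Type u} [CommRing Q]

/-- `HasFreeRes J L N b` says that the `Q`-module `N` admits the first `L` steps of a resolution by
finite free `Q ⧸ J`-modules, the `i`-th one of rank `b i`. -/
def HasFreeRes (J : Ideal Q) :
    ℕ → ∀ (N : Type u) [AddCommGroup N] [Module Q N], (ℕ → ℕ) → Prop
  | 0, _, _, _, _ => True
  | L + 1, N, _, _, b => ∃ f : (Fin (b 0) → Q ⧸ J) →ₗ[Q] N, Function.Surjective f ∧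
      HasFreeRes J L (LinearMap.ker f) (fun i => b (i + 1))

namespace HasFreeRes

variable {J : Ideal Q} {A N N' E C : Type u}
  [AddCommGroup A] [Module Q A] [AddCommGroup N] [Module Q N] [AddCommGroup N'] [Module Q N']
  [AddCommGroup E] [Module Q E] [AddCommGroup C] [Module Q C]

lemma congr {L : ℕ} {b : ℕ → ℕ} (h : HasFreeRes J L N b) (e : N ≃ₗ[Q] N') :
    HasFreeRes J L N' b := by
  induction L generalizing N N' b with
  | zero => trivial
  | succ L ih =>
    obtain ⟨f, hf, hk⟩ := h
    refine ⟨e.toLinearMap ∘ₗ f, e.surjective.comp hf, ih hk (LinearEquiv.ofEq _ _ ?_)⟩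
    simp

/-- A surjection onto `N` from a free module, whose kernel has a resolution. -/
lemma of_surjective {L : ℕ} {b : ℕ → ℕ} {F : Type u} [AddCommGroup F] [Module Q F]
    (e : (Fin (b 0) → Q ⧸ J) ≃ₗ[Q] F) (f : F →ₗ[Q] N) (hf : Function.Surjective f)
    (h : HasFreeRes J L (LinearMap.ker f) (fun i => b (i + 1))) :
    HasFreeRes J (L + 1) N b := by
  refine ⟨f ∘ₗ e.toLinearMap, hf.comp e.surjective, h.congr ?_⟩
  rw [LinearMap.ker_comp]
  exact (e.ofSubmodule' _).symm

lemma of_succ {L : ℕ} {b : ℕ → ℕ} (h : HasFreeRes J (L + 1) N b) : HasFreeRes J L N b := by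
  induction L generalizing N b with
  | zero => trivial
  | succ L ih =>
    obtain ⟨f, hf, hk⟩ := h
    exact ⟨f, hf, ih hk⟩

lemma of_subsingleton [Subsingleton N] (L : ℕ) : HasFreeRes J L N (fun _ => 0) := by
  induction L generalizing N with
  | zero => trivial
  | succ L ih => exact ⟨0, fun x => ⟨0, Subsingleton.elim _ _⟩, ih⟩

lemma of_free {L k : ℕ} (e : (Fin k → Q ⧸ J) ≃ₗ[Q] N) :
    HasFreeRes J L N (fun i => if i = 0 then k else 0) := by
  cases L with
  | zero => trivial
  | succ L =>
    refine of_surjective (b := fun i => if i = 0 then k else 0) e LinearMap.id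
      Function.surjective_id ?_
    have : Subsingleton (LinearMap.ker (LinearMap.id : N →ₗ[Q] N)) :=
      ⟨fun x y => Subtype.ext (x.2.trans y.2.symm)⟩
    exact of_subsingleton L

/-- Maps out of a finite free `Q ⧸ J`-module lift along surjections of modules killed by `J`. -/
lemma exists_lift {k : ℕ} (hE : ∀ x ∈ J, ∀ e : E, x • e = 0) (p : E →ₗ[Q] C)
    (hp : Function.Surjective p) (f : (Fin k → Q ⧸ J) →ₗ[Q] C) :
    ∃ s : (Fin k → Q ⧸ J) →ₗ[Q] E, p ∘ₗ s = f := by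
  choose g hg using fun i => hp (f (Pi.single i 1))
  let t : Fin k → (Q ⧸ J) →ₗ[Q] E := fun i =>
    Submodule.liftQ J (LinearMap.toSpanSingleton Q E (g i)) fun x hx => by
      simpa using hE x hx (g i)
  refine ⟨LinearMap.lsum Q (fun _ => Q ⧸ J) Q t, ?_⟩
  ext i
  have h1 : LinearMap.lsum Q (fun _ => Q ⧸ J) Q t (Pi.single i 1) = g i := by
    rw [LinearMap.lsum_piSingle]
    exact (Submodule.liftQ_apply J _ 1).trans (one_smul Q (g i))
  change p (LinearMap.lsum Q (fun _ => Q ⧸ J) Q t (Pi.single i 1)) = f (Pi.single i 1)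
  rw [h1, hg]

lemma smul_quotient_eq_zero {x : Q} (hx : x ∈ J) (q : Q ⧸ J) : x • q = 0 := by
  obtain ⟨q, rfl⟩ := Ideal.Quotient.mk_surjective q
  rw [← Ideal.Quotient.mk_eq_mk, ← Submodule.Quotient.mk_smul, Submodule.Quotient.mk_eq_zero]
  exact J.mul_mem_right _ hx

/-- The horseshoe lemma. -/
lemma horseshoe {L : ℕ} {α γ : ℕ → ℕ} (hE : ∀ x ∈ J, ∀ e : E, x • e = 0)
    (i : A →ₗ[Q] E) (p : E →ₗ[Q] C) (hi : Function.Injective i) (hp : Function.Surjective p)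
    (hip : Function.Exact i p) (hA : HasFreeRes J L A α) (hC : HasFreeRes J L C γ) :
    HasFreeRes J L E (fun k => α k + γ k) := by
  induction L generalizing A E C α γ with
  | zero => trivial
  | succ L ih =>
    obtain ⟨f, hf, hfk⟩ := hA
    obtain ⟨g, hg, hgk⟩ := hC
    obtain ⟨s, hs⟩ := exists_lift hE p hp g
    have hs' : ∀ y, p (s y) = g y := fun y => by rw [← hs]; rfl
    have hpi : ∀ a, p (i a) = 0 := fun a => hip.apply_apply_eq_zero a
    let h := (i ∘ₗ f).coprod s
    have hh : ∀ z, h z = i (f z.1) + s z.2 := fun z => by simp [h]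
    have key : ∀ y e, p e = g y → ∃ x, h (x, y) = e := fun y e hy => by
      obtain ⟨a, ha⟩ := (hip (e - s y)).1 (by rw [map_sub, hs', hy, sub_self])
      obtain ⟨x, rfl⟩ := hf a
      exact ⟨x, by rw [hh, ha]; simp⟩
    refine of_surjective (b := fun k => α k + γ k)
      ((LinearEquiv.funCongrLeft Q (Q ⧸ J) finSumFinEquiv).trans
        (LinearEquiv.sumArrowLequivProdArrow _ _ Q (Q ⧸ J))) h ?_ ?_
    · intro e
      obtain ⟨y, hy⟩ := hg (p e)
      obtain ⟨x, hx⟩ := key y e hy.symm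
      exact ⟨_, hx⟩
    · let i' : LinearMap.ker f →ₗ[Q] LinearMap.ker h :=
        (LinearMap.inl Q _ _).restrict fun x hx => by
          rw [LinearMap.mem_ker] at hx ⊢; simp [hh, hx]
      let p' : LinearMap.ker h →ₗ[Q] LinearMap.ker g :=
        (LinearMap.snd Q _ _).restrict fun z hz => by
          rw [LinearMap.mem_ker] at hz ⊢
          have h1 := congrArg p (hh z)
          rw [hz, map_zero, map_add, hpi, zero_add, hs'] at h1
          exact h1.symm
      refine ih ?_ i' p' ?_ ?_ ?_ hfk hgk
      · rintro x hx ⟨⟨z, w⟩, hz⟩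
        ext k
        · exact smul_quotient_eq_zero hx (z k)
        · exact smul_quotient_eq_zero hx (w k)
      · intro x y hxy
        have := congrArg (fun z => z.1.1) hxy
        exact Subtype.ext this
      · rintro ⟨y, hy⟩
        obtain ⟨x, hx⟩ := key y 0 (by rw [map_zero, LinearMap.mem_ker.1 hy])
        exact ⟨⟨(x, y), hx⟩, rfl⟩
      · rintro ⟨⟨x, y⟩, hz⟩
        constructor
        · intro h0
          have hy : y = 0 := congrArg Subtype.val h0
          subst hy
          refine ⟨⟨x, ?_⟩, rfl⟩
          have : i (f x) = 0 := by simpa [hh] using hz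
          exact hi (by rw [this, map_zero])
        · rintro ⟨w, hw⟩
          have : y = 0 := (congrArg (fun z => z.1.2) hw).symm
          subst this
          rfl

/-- The mapping cone of a resolution of a submodule resolves the quotient. -/
lemma cone {L : ℕ} {α β : ℕ → ℕ} (i : A →ₗ[Q] E) (p : E →ₗ[Q] C) (hi : Function.Injective i)
    (hp : Function.Surjective p) (hip : Function.Exact i p) (hA : HasFreeRes J L A α)
    (hE : HasFreeRes J (L + 1) E β) {γ : ℕ → ℕ} (h0 : γ 0 = β 0)
    (hs : ∀ k, γ (k + 1) = β (k + 1) + α k) :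
    HasFreeRes J (L + 1) C γ := by
  obtain ⟨f, hf, hk⟩ := hE
  have hfun : (fun k => γ (k + 1)) = fun k => β (k + 1) + α k := funext hs
  have hpi : ∀ a, p (i a) = 0 := fun a => hip.apply_apply_eq_zero a
  refine of_surjective (b := γ) (LinearEquiv.funCongrLeft Q (Q ⧸ J) (finCongr h0.symm))
    (p ∘ₗ f) (hp.comp hf) ?_
  rw [hfun]
  let j : LinearMap.ker f →ₗ[Q] LinearMap.ker (p ∘ₗ f) :=
    Submodule.inclusion (LinearMap.ker_le_ker_comp f p)
  let t : LinearMap.ker (p ∘ₗ f) →ₗ[Q] LinearMap.range i :=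
    f.restrict fun x hx => (hip _).1 hx
  let e := LinearEquiv.ofInjective i hi
  refine horseshoe ?_ j t (Submodule.inclusion_injective _) ?_ ?_ hk (hA.congr e)
  · rintro x hx ⟨z, hz⟩
    ext k
    exact smul_quotient_eq_zero hx (z k)
  · rintro ⟨_, a, rfl⟩
    obtain ⟨x, hx⟩ := hf (i a)
    exact ⟨⟨x, by simp [hx, hpi]⟩, Subtype.ext hx⟩
  · rintro ⟨x, hx⟩
    constructor
    · intro h
      exact ⟨⟨x, congrArg Subtype.val h⟩, rfl⟩
    · rintro ⟨y, hy⟩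
      have : x = y.1 := (congrArg Subtype.val hy).symm
      subst this
      exact Subtype.ext y.2

section ChangeOfRings

variable (J) (a : Q)

/-- Reduction of a free `Q ⧸ J`-module modulo a further element. -/
def reduceFree (k : ℕ) : (Fin k → Q ⧸ J) →ₗ[Q] (Fin k → Q ⧸ (J ⊔ Ideal.span {a})) :=
  LinearMap.compLeft (Submodule.mapQ J (J ⊔ Ideal.span {a}) LinearMap.id
    (fun _ hx => Submodule.mem_sup_left hx)) (Fin k)

lemma reduceFree_surjective (k : ℕ) : Function.Surjective (reduceFree J a k) := by
  intro y
  choose q hq using fun i => Submodule.Quotient.mk_surjective _ (y i)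
  refine ⟨fun i => Submodule.Quotient.mk (q i), funext fun i => ?_⟩
  rw [← hq i]
  rfl

lemma ker_reduceFree (k : ℕ) (x : Fin k → Q ⧸ J) :
    reduceFree J a k x = 0 ↔ ∃ y, a • y = x := by
  constructor
  · intro h
    have : ∀ i, ∃ y : Q ⧸ J, a • y = x i := fun i => by
      obtain ⟨q, hq⟩ := Submodule.Quotient.mk_surjective _ (x i)
      have hi : reduceFree J a k x i = 0 := congrFun h i
      have hi' : reduceFree J a k x i = Submodule.Quotient.mk q := by
        change Submodule.mapQ J (J ⊔ Ideal.span {a}) LinearMap.id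
          (fun _ hx => Submodule.mem_sup_left hx) (x i) = _
        rw [← hq]; rfl
      rw [hi', Submodule.Quotient.mk_eq_zero, Submodule.mem_sup] at hi
      obtain ⟨j, hj, z, hz, rfl⟩ := hi
      obtain ⟨w, rfl⟩ := Ideal.mem_span_singleton'.1 hz
      refine ⟨Submodule.Quotient.mk w, ?_⟩
      rw [← hq, ← Submodule.Quotient.mk_smul, eq_comm, Submodule.Quotient.eq, smul_eq_mul,
        mul_comm a w]
      simpa using hj
    choose y hy using this
    exact ⟨y, funext hy⟩
  · rintro ⟨y, rfl⟩
    rw [map_smul]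
    exact funext fun i => smul_quotient_eq_zero
      (Submodule.mem_sup_right (Ideal.mem_span_singleton_self a)) _

/-- Maps killing `a` times a free `Q ⧸ J`-module factor through its reduction. -/
lemma exists_comp_reduceFree {k : ℕ} (f : (Fin k → Q ⧸ J) →ₗ[Q] N)
    (hf : ∀ y, f (a • y) = 0) :
    ∃ g : (Fin k → Q ⧸ (J ⊔ Ideal.span {a})) →ₗ[Q] N, ∀ x, g (reduceFree J a k x) = f x := by
  let e := (reduceFree J a k).quotKerEquivOfSurjective (reduceFree_surjective J a k)
  have hle : LinearMap.ker (reduceFree J a k) ≤ LinearMap.ker f := fun x hx => by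
    obtain ⟨y, rfl⟩ := (ker_reduceFree J a k x).1 hx
    exact hf y
  refine ⟨(LinearMap.ker (reduceFree J a k)).liftQ f hle ∘ₗ e.symm.toLinearMap, fun x => ?_⟩
  have : e.symm (reduceFree J a k x) = Submodule.Quotient.mk x := by
    rw [LinearEquiv.symm_apply_eq]; rfl
  change (LinearMap.ker (reduceFree J a k)).liftQ f hle (e.symm (reduceFree J a k x)) = _
  rw [this]; rfl

variable {J a}

/-- Reducing a resolution modulo an element regular on the module and on `Q ⧸ J`. -/
lemma quotSMulTop {L : ℕ} {b : ℕ → ℕ} (ha : IsSMulRegular (Q ⧸ J) a) (hN : IsSMulRegular N a)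
    (h : HasFreeRes J L N b) : HasFreeRes (J ⊔ Ideal.span {a}) L (QuotSMulTop a N) b := by
  induction L generalizing N b with
  | zero => trivial
  | succ L ih =>
    obtain ⟨f, hf, hk⟩ := h
    have hF : IsSMulRegular (Fin (b 0) → Q ⧸ J) a := IsSMulRegular.pi fun _ => ha
    let r := reduceFree J a (b 0)
    have hr : Function.Surjective r := reduceFree_surjective J a _
    obtain ⟨g, hg⟩ := exists_comp_reduceFree J a ((a • (⊤ : Submodule Q N)).mkQ ∘ₗ f) fun y => by
      rw [LinearMap.comp_apply, map_smul, Submodule.mkQ_apply, Submodule.Quotient.mk_eq_zero]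
      exact Submodule.smul_mem_pointwise_smul _ _ _ trivial
    replace hg : ∀ x, g (r x) = Submodule.Quotient.mk (f x) := hg
    refine ⟨g, ?_, (ih (hF.submodule _ _) hk).congr ?_⟩
    · intro y
      obtain ⟨y, rfl⟩ := Submodule.Quotient.mk_surjective _ y
      obtain ⟨x, rfl⟩ := hf y
      exact ⟨r x, hg x⟩
    · let t : LinearMap.ker f →ₗ[Q] LinearMap.ker g := r.restrict fun x hx => by
        rw [LinearMap.mem_ker] at hx ⊢
        rw [hg, hx]; rfl
      have ht : Function.Surjective t := by
        rintro ⟨y, hy⟩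
        obtain ⟨x, rfl⟩ := hr y
        rw [LinearMap.mem_ker, hg, Submodule.Quotient.mk_eq_zero] at hy
        obtain ⟨n, -, hn⟩ := (Submodule.mem_smul_pointwise_iff_exists _ _ _).1 hy
        obtain ⟨z, rfl⟩ := hf n
        refine ⟨⟨x - a • z, by simp [← hn]⟩, Subtype.ext ?_⟩
        change r (x - a • z) = r x
        rw [map_sub, (ker_reduceFree J a _ _).2 ⟨z, rfl⟩, sub_zero]
      have hker : (a • ⊤ : Submodule Q (LinearMap.ker f)) = LinearMap.ker t := by
        ext ⟨x, hx⟩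
        rw [Submodule.mem_smul_pointwise_iff_exists, LinearMap.mem_ker]
        constructor
        · rintro ⟨y, -, hy⟩
          exact Subtype.ext ((ker_reduceFree J a _ _).2 ⟨y.1, congrArg Subtype.val hy⟩)
        · intro h
          obtain ⟨y, rfl⟩ := (ker_reduceFree J a _ _).1 (congrArg Subtype.val h)
          refine ⟨⟨y, ?_⟩, trivial, rfl⟩
          rw [LinearMap.mem_ker, map_smul] at hx
          exact hN (hx.trans (smul_zero a).symm)
      exact (Submodule.quotEquivOfEq _ _ hker).trans (t.quotKerEquivOfSurjective ht)

/-- The ranks of the resolution obtained by passing to the quotient by one regular element. -/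
def _root_.hypersurfaceRanks (b : ℕ → ℕ) : ℕ → ℕ
  | 0 => b 0
  | 1 => b 1
  | k + 2 => b (k + 2) + hypersurfaceRanks b k

/-- Change of rings: a module killed by a regular element `a` of `Q ⧸ J` has a resolution over
`Q ⧸ (J + (a))` obtained from one over `Q ⧸ J`. -/
lemma changeOfRings {L : ℕ} {b : ℕ → ℕ} (ha : IsSMulRegular (Q ⧸ J) a) (haN : ∀ x : N, a • x = 0)
    (h : HasFreeRes J L N b) : HasFreeRes (J ⊔ Ideal.span {a}) L N (hypersurfaceRanks b) := by
  induction L using Nat.strong_induction_on with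
  | _ L ih =>
  match L with
  | 0 => trivial
  | L + 1 =>
    have h' := h.of_succ
    obtain ⟨f, hf, hk⟩ := h
    have hF : IsSMulRegular (Fin (b 0) → Q ⧸ J) a := IsSMulRegular.pi fun _ => ha
    let r := reduceFree J a (b 0)
    have hr : Function.Surjective r := reduceFree_surjective J a _
    have haf : ∀ y, a • y ∈ LinearMap.ker f := fun y => by
      rw [LinearMap.mem_ker, map_smul, haN]
    obtain ⟨g, hg⟩ := exists_comp_reduceFree J a f haf
    replace hg : ∀ x, g (r x) = f x := hg
    refine ⟨g, fun y => ?_, ?_⟩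
    · obtain ⟨x, rfl⟩ := hf y
      exact ⟨r x, hg x⟩
    match L with
    | 0 => trivial
    | l + 1 =>
      let t : LinearMap.ker f →ₗ[Q] LinearMap.ker g := r.restrict fun x hx => by
        rw [LinearMap.mem_ker] at hx ⊢
        rw [hg, hx]
      let p : QuotSMulTop a (LinearMap.ker f) →ₗ[Q] LinearMap.ker g :=
        Submodule.liftQ _ t fun x hx => by
          obtain ⟨y, -, rfl⟩ := (Submodule.mem_smul_pointwise_iff_exists _ _ _).1 hx
          exact Subtype.ext ((ker_reduceFree J a _ _).2 ⟨y.1, rfl⟩)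
      have hp : ∀ x, p (Submodule.Quotient.mk x) = t x := fun x => rfl
      let m : (Fin (b 0) → Q ⧸ J) →ₗ[Q] QuotSMulTop a (LinearMap.ker f) :=
        Submodule.mkQ _ ∘ₗ (LinearMap.lsmul Q _ a).codRestrict (LinearMap.ker f) haf
      have hm : ∀ y, m y = Submodule.Quotient.mk ⟨a • y, haf y⟩ := fun y => rfl
      have hmk : LinearMap.ker f = LinearMap.ker m := by
        ext x
        rw [LinearMap.mem_ker (f := m), hm, Submodule.Quotient.mk_eq_zero,
          Submodule.mem_smul_pointwise_iff_exists]
        constructor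
        · intro hx
          exact ⟨⟨x, hx⟩, trivial, rfl⟩
        · rintro ⟨y, -, hy⟩
          have : y.1 = x := hF (congrArg Subtype.val hy)
          exact this ▸ y.2
      let e' : ((Fin (b 0) → Q ⧸ J) ⧸ LinearMap.ker m) ≃ₗ[Q] N :=
        (Submodule.quotEquivOfEq _ _ hmk.symm).trans (f.quotKerEquivOfSurjective hf)
      refine cone ((LinearMap.ker m).liftQ m le_rfl) p ?_ ?_ ?_
        ((ih l (by omega) h'.of_succ).congr e'.symm)
        (quotSMulTop ha (hF.submodule _ _) hk) rfl (fun k => rfl)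
      · exact LinearMap.ker_eq_bot.1 (Submodule.ker_liftQ_eq_bot' _ _ rfl)
      · rintro ⟨y, hy⟩
        obtain ⟨x, rfl⟩ := hr y
        rw [LinearMap.mem_ker, hg] at hy
        exact ⟨Submodule.Quotient.mk ⟨x, hy⟩, rfl⟩
      · intro y
        obtain ⟨⟨y, hy⟩, rfl⟩ := Submodule.Quotient.mk_surjective _ y
        constructor
        · intro h0
          obtain ⟨z, rfl⟩ := (ker_reduceFree J a _ _).1 (congrArg Subtype.val h0)
          exact ⟨Submodule.Quotient.mk z, rfl⟩
        · rintro ⟨z, hz⟩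
          obtain ⟨z, rfl⟩ := Submodule.Quotient.mk_surjective _ z
          rw [← hz]
          change p (m z) = 0
          exact Subtype.ext ((ker_reduceFree J a _ _).2 ⟨z, rfl⟩)

end ChangeOfRings

end HasFreeRes
end FreeRes

section Taylor

variable {𝕜 : Type u} [Field 𝕜] {n : ℕ}

lemma mem_span_range_monomial {ι : Type*} (v : ι → (Fin n →₀ ℕ)) (x : MvPolynomial (Fin n) 𝕜) :
    x ∈ Ideal.span (Set.range fun j => monomial (v j) (1 : 𝕜)) ↔
      ∀ d ∈ x.support, ∃ j, v j ≤ d := by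
  have : (Set.range fun j => monomial (v j) (1 : 𝕜)) =
      (fun s => monomial s (1 : 𝕜)) '' Set.range v := by
    rw [← Set.range_comp]; rfl
  rw [this, mem_ideal_span_monomial_image]
  simp

/-- Colon ideals of monomial ideals by monomials. -/
lemma mul_monomial_mem_span_range {ι : Type*} (v : ι → (Fin n →₀ ℕ)) (u : Fin n →₀ ℕ)
    (x : MvPolynomial (Fin n) 𝕜) :
    x * monomial u 1 ∈ Ideal.span (Set.range fun j => monomial (v j) (1 : 𝕜)) ↔
      x ∈ Ideal.span (Set.range fun j => monomial (v j - u) (1 : 𝕜)) := by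
  rw [mem_span_range_monomial, mem_span_range_monomial]
  constructor
  · intro h d hd
    obtain ⟨j, hj⟩ := h (d + u) (by
      rw [mem_support_iff, coeff_mul_monomial, mul_one]; exact mem_support_iff.1 hd)
    exact ⟨j, tsub_le_iff_right.2 hj⟩
  · intro h d hd
    rw [mem_support_iff, coeff_mul_monomial'] at hd
    split_ifs at hd with hu
    · rw [mul_one] at hd
      obtain ⟨j, hj⟩ := h (d - u) (mem_support_iff.2 hd)
      exact ⟨j, (tsub_le_tsub_iff_right hu).1 hj⟩
    · exact absurd rfl hd

/-- The quotient by an ideal generated by `r` monomials has a free resolution with the ranks of the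
Taylor resolution. -/
lemma HasFreeRes.taylor {r : ℕ} (v : Fin r → (Fin n →₀ ℕ)) (L : ℕ) :
    HasFreeRes (⊥ : Ideal (MvPolynomial (Fin n) 𝕜)) L
      (MvPolynomial (Fin n) 𝕜 ⧸ Ideal.span (Set.range fun j => monomial (v j) (1 : 𝕜)))
      (fun i => r.choose i) := by
  induction r generalizing L with
  | zero =>
    have hI : Ideal.span (Set.range fun j => monomial (v j) (1 : 𝕜)) = ⊥ := by simp
    have hb : (fun i => Nat.choose 0 i) = fun i => if i = 0 then 1 else 0 := by
      funext i; cases i <;> rfl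
    rw [hb, hI]
    exact of_free (LinearEquiv.funUnique (Fin 1) _ _)
  | succ r ih =>
    cases L with
    | zero => trivial
    | succ L =>
      let u := v (Fin.last r)
      let v' : Fin r → (Fin n →₀ ℕ) := fun j => v j.castSucc
      let I := Ideal.span (Set.range fun j => monomial (v j) (1 : 𝕜))
      let I' := Ideal.span (Set.range fun j => monomial (v' j) (1 : 𝕜))
      let K := Ideal.span (Set.range fun j => monomial (v' j - u) (1 : 𝕜))
      have hI : ∀ x, x ∈ I ↔ ∃ y, x - y * monomial u 1 ∈ I' := fun x => by
        have : I = I' ⊔ Ideal.span {monomial u (1 : 𝕜)} := by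
          apply le_antisymm
          · refine Ideal.span_le.2 ?_
            rintro _ ⟨j, rfl⟩
            induction j using Fin.lastCases with
            | last => exact Submodule.mem_sup_right (Ideal.mem_span_singleton_self _)
            | cast j => exact Submodule.mem_sup_left (Ideal.subset_span ⟨j, rfl⟩)
          · refine sup_le (Ideal.span_mono ?_) (Ideal.span_mono ?_)
            · rintro _ ⟨j, rfl⟩
              exact ⟨j.castSucc, rfl⟩
            · rintro _ rfl
              exact ⟨Fin.last r, rfl⟩
        rw [this, Submodule.mem_sup]
        constructor
        · rintro ⟨y, hy, z, hz, rfl⟩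
          obtain ⟨w, rfl⟩ := Ideal.mem_span_singleton'.1 hz
          exact ⟨w, by simpa using hy⟩
        · rintro ⟨y, hy⟩
          exact ⟨_, hy, _, Ideal.mem_span_singleton'.2 ⟨y, rfl⟩, by simp⟩
      have hle : I' ≤ I := fun x hx => (hI x).2 ⟨0, by simpa using hx⟩
      let i : (MvPolynomial (Fin n) 𝕜 ⧸ K) →ₗ[MvPolynomial (Fin n) 𝕜]
          (MvPolynomial (Fin n) 𝕜 ⧸ I') :=
        Submodule.mapQ K I' (LinearMap.mulRight _ (monomial u 1)) fun x hx =>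
          (mul_monomial_mem_span_range v' u x).2 hx
      let p : (MvPolynomial (Fin n) 𝕜 ⧸ I') →ₗ[MvPolynomial (Fin n) 𝕜]
          (MvPolynomial (Fin n) 𝕜 ⧸ I) :=
        Submodule.mapQ I' I LinearMap.id hle
      refine cone i p ?_ ?_ ?_ (ih (fun j => v' j - u) L) (ih v' (L + 1)) (by simp) fun k => ?_
      · rw [← LinearMap.ker_eq_bot, LinearMap.ker_eq_bot']
        intro x hx
        obtain ⟨x, rfl⟩ := Submodule.Quotient.mk_surjective _ x
        refine (Submodule.Quotient.mk_eq_zero _).2 ((mul_monomial_mem_span_range v' u x).1 ?_)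
        exact (Submodule.Quotient.mk_eq_zero _).1 hx
      · intro x
        obtain ⟨x, rfl⟩ := Submodule.Quotient.mk_surjective _ x
        exact ⟨Submodule.Quotient.mk x, rfl⟩
      · intro x
        obtain ⟨x, rfl⟩ := Submodule.Quotient.mk_surjective _ x
        change Submodule.Quotient.mk x = 0 ↔ _
        rw [Submodule.Quotient.mk_eq_zero, hI]
        constructor
        · rintro ⟨y, hy⟩
          exact ⟨Submodule.Quotient.mk y, ((Submodule.Quotient.eq _).2 hy).symm⟩
        · rintro ⟨y, hy⟩
          obtain ⟨y, rfl⟩ := Submodule.Quotient.mk_surjective _ y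
          exact ⟨y, (Submodule.Quotient.eq _).1 hy.symm⟩
      · rw [Nat.choose_succ_succ', add_comm]

/-- The ranks obtained from those of the Taylor resolution on `r` generators by passing to a
complete intersection of codimension `c`. -/
def ciRanks (r : ℕ) : ℕ → ℕ → ℕ
  | 0 => r.choose
  | c + 1 => hypersurfaceRanks (ciRanks r c)

lemma ciRanks_odd (r c m : ℕ) : ciRanks r c (2 * m + 1) =
    ∑ j ∈ Finset.range (m + 1), r.choose (2 * j + 1) * c.multichoose (m - j) := by
  induction c generalizing m with
  | zero =>
    rw [Finset.sum_range_succ, Finset.sum_eq_zero]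
    · simp [ciRanks]
    · intro j hj
      obtain ⟨k, hk⟩ : ∃ k, m - j = k + 1 := ⟨m - j - 1, by have := Finset.mem_range.1 hj; omega⟩
      simp [hk]
  | succ c ih =>
    induction m with
    | zero => simpa [ciRanks, hypersurfaceRanks] using ih 0
    | succ m ihm =>
      change ciRanks r c (2 * (m + 1) + 1) + ciRanks r (c + 1) (2 * m + 1) = _
      rw [ih, ihm, Finset.sum_range_succ, Finset.sum_range_succ _ (m + 1), add_right_comm,
        ← Finset.sum_add_distrib]
      congr 1
      · refine Finset.sum_congr rfl fun j hj => ?_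
        rw [Nat.succ_sub (Nat.le_of_lt_succ (Finset.mem_range.1 hj)), Nat.multichoose_succ_succ,
          mul_add]
      · simp

lemma ciRanks_odd_le (r c m : ℕ) : ciRanks r c (2 * m + 1) ≤
    ∑ j ∈ Finset.range (m + 1), r.choose (2 * j + 1) * (c + m - j - 1).choose (c - 1) := by
  rw [ciRanks_odd]
  refine Finset.sum_le_sum fun j hj => Nat.mul_le_mul_left _ ?_
  have hj := Finset.mem_range.1 hj
  cases c with
  | zero =>
    cases m - j <;> simp
  | succ c =>
    have h : c + 1 + m - j - 1 = c + (m - j) := by omega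
    rw [Nat.multichoose_eq, h, show c + 1 + (m - j) - 1 = c + (m - j) by omega]
    exact (Nat.choose_symm_add).symm.le

/-- The quotient by a monomial ideal, resolved over a complete intersection. -/
lemma HasFreeRes.completeIntersection {r c : ℕ} (v : Fin r → (Fin n →₀ ℕ))
    (a : Fin c → MvPolynomial (Fin n) 𝕜)
    (hreg : RingTheory.Sequence.IsWeaklyRegular (MvPolynomial (Fin n) 𝕜) (List.ofFn a))
    (hmem : ∀ i, a i ∈ Ideal.span (Set.range fun j => monomial (v j) (1 : 𝕜))) (L : ℕ) :
    HasFreeRes (Ideal.span (Set.range a)) L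
      (MvPolynomial (Fin n) 𝕜 ⧸ Ideal.span (Set.range fun j => monomial (v j) (1 : 𝕜)))
      (ciRanks r c) := by
  have key : ∀ k, k ≤ c → HasFreeRes (Ideal.ofList ((List.ofFn a).take k)) L
      (MvPolynomial (Fin n) 𝕜 ⧸ Ideal.span (Set.range fun j => monomial (v j) (1 : 𝕜)))
      (ciRanks r k) := by
    intro k hk
    induction k with
    | zero =>
      rw [List.take_zero, Ideal.ofList_nil]
      exact taylor v L
    | succ k ih =>
      have hk' : k < (List.ofFn a).length := by simpa using hk
      have h := hreg.regular_mod_prev k hk'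
      rw [smul_eq_mul, Ideal.mul_top] at h
      rw [← List.take_append_getElem hk', Ideal.ofList_append, Ideal.ofList_singleton]
      refine changeOfRings h (fun x => ?_) (ih (by omega))
      refine smul_quotient_eq_zero ?_ x
      rw [List.getElem_ofFn]
      exact hmem _
  have h := key c le_rfl
  rw [List.take_of_length_le (by simp)] at h
  have : Ideal.ofList (List.ofFn a) = Ideal.span (Set.range a) := by
    rw [Ideal.ofList]; congr 1; ext x; simp [List.mem_ofFn]
  rwa [this] at h

end Taylor

section Splice

open CategoryTheory.Limits

variable {C : Type*} [Category* C] [Abelian C]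

/-- Splicing a projective resolution of a syzygy with a projective cover. -/
lemma CategoryTheory.ShortComplex.ShortExact.exists_projectiveResolution {S : ShortComplex C}
    (hS : S.ShortExact) [Projective S.X₂] (P : ProjectiveResolution S.X₁) :
    ∃ P' : ProjectiveResolution S.X₃, P'.complex.X 0 = S.X₂ ∧
      ∀ i, P'.complex.X (i + 1) = P.complex.X i := by
  have hmono := hS.mono_f
  have hepi := hS.epi_g
  let ε : P.complex.X 0 ⟶ S.X₁ := P.π.f 0
  have hε : P.complex.d 1 0 ≫ ε = 0 := P.complex_d_comp_π_f_zero
  have hεepi : Epi ε := inferInstanceAs (Epi (P.π.f 0))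
  have hexε : (ShortComplex.mk _ ε hε).Exact :=
    ShortComplex.exact_of_g_is_cokernel _ P.isColimitCokernelCofork
  have hw : P.complex.d 1 0 ≫ ε ≫ S.f = 0 := by rw [← Category.assoc, hε, zero_comp]
  let K : ChainComplex C ℕ := ChainComplex.augment P.complex (ε ≫ S.f) hw
  have hwK : K.d 1 0 ≫ S.g = 0 := by
    change (ε ≫ S.f) ≫ S.g = 0
    rw [Category.assoc, S.zero, comp_zero]
  have hex0 : (ShortComplex.mk (K.d 1 0) S.g hwK).Exact := by
    let φ : ShortComplex.mk (K.d 1 0) S.g hwK ⟶ S :=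
      { τ₁ := ε, τ₂ := 𝟙 _, τ₃ := 𝟙 _
        comm₁₂ := (Category.comp_id _).symm
        comm₂₃ := (Category.id_comp _).trans (Category.comp_id _).symm }
    have : Epi φ.τ₁ := hεepi
    have : IsIso φ.τ₂ := inferInstanceAs (IsIso (𝟙 _))
    have : Mono φ.τ₃ := inferInstanceAs (Mono (𝟙 _))
    exact (ShortComplex.exact_iff_of_epi_of_isIso_of_mono φ).2 hS.exact
  have hex : ∀ n, K.ExactAt (n + 1) := fun n => by
    rw [HomologicalComplex.exactAt_iff' _ (n + 1 + 1) (n + 1) n (by simp) (by simp)]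
    cases n with
    | zero =>
      let φ : ShortComplex.mk (P.complex.d 1 0) ε hε ⟶ K.sc' 2 1 0 :=
        { τ₁ := 𝟙 _, τ₂ := 𝟙 _, τ₃ := S.f
          comm₁₂ := (Category.id_comp _).trans (Category.comp_id _).symm
          comm₂₃ := Category.id_comp _ }
      have : Epi φ.τ₁ := inferInstanceAs (Epi (𝟙 _))
      have : IsIso φ.τ₂ := inferInstanceAs (IsIso (𝟙 _))
      have : Mono φ.τ₃ := hmono
      exact (ShortComplex.exact_iff_of_epi_of_isIso_of_mono φ).1 hexε
    | succ n => exact P.exact_succ n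
  have hπ : ((ChainComplex.toSingle₀Equiv K S.X₃).symm ⟨S.g, hwK⟩).f 0 = S.g :=
    ChainComplex.toSingle₀Equiv_symm_apply_f_zero _ _
  refine ⟨{
    complex := K
    projective := fun n => by
      cases n with
      | zero => exact inferInstanceAs (Projective S.X₂)
      | succ n => exact P.projective n
    π := (ChainComplex.toSingle₀Equiv _ _).symm ⟨S.g, hwK⟩
    quasiIso := ⟨fun n => ?_⟩ }, rfl, fun _ => rfl⟩
  cases n with
  | zero =>
    rw [ChainComplex.quasiIsoAt₀_iff, ShortComplex.quasiIso_iff_of_zeros']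
    · refine (ShortComplex.exact_and_epi_g_iff_of_iso ?_).2 ⟨hex0, hepi⟩
      exact ShortComplex.isoMk (Iso.refl _) (Iso.refl _) (Iso.refl _)
        ((Category.id_comp _).trans (Category.comp_id _).symm)
        ((Category.id_comp _).trans (hπ.symm.trans (Category.comp_id _).symm))
    all_goals rfl
  | succ n =>
    rw [quasiIsoAt_iff_exactAt']
    · exact hex n
    · exact ChainComplex.exactAt_succ_single_obj _ _

end Splice

section TorBound

open scoped TensorProduct MonoidalCategory

/-- A resolution by free `Q ⧸ J`-modules gives projective resolutions in `ModuleCat (Q ⧸ J)`. -/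
lemma HasFreeRes.exists_projectiveResolution {Q : Type u} [CommRing Q] {J : Ideal Q} (i : ℕ)
    {b : ℕ → ℕ} {N : Type u} [AddCommGroup N] [Module Q N] [Module (Q ⧸ J) N]
    [IsScalarTower Q (Q ⧸ J) N] (h : HasFreeRes J (i + 1) N b) :
    ∃ P : ProjectiveResolution (ModuleCat.of (Q ⧸ J) N),
      Nonempty (P.complex.X i ≅ ModuleCat.of (Q ⧸ J) (Fin (b i) → Q ⧸ J)) := by
  induction i generalizing b N with
  | zero =>
    obtain ⟨f, hf, -⟩ := h
    let g : (Fin (b 0) → Q ⧸ J) →ₗ[Q ⧸ J] N :=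
      f.extendScalarsOfSurjective Ideal.Quotient.mk_surjective
    have hS := g.shortExact_shortComplexKer hf
    have : Projective g.shortComplexKer.X₂ :=
      inferInstanceAs (Projective (ModuleCat.of (Q ⧸ J) (Fin (b 0) → Q ⧸ J)))
    obtain ⟨P, h0, -⟩ := hS.exists_projectiveResolution (ProjectiveResolution.of _)
    exact ⟨P, ⟨eqToIso h0⟩⟩
  | succ i ih =>
    obtain ⟨f, hf, hk⟩ := h
    let g : (Fin (b 0) → Q ⧸ J) →ₗ[Q ⧸ J] N :=
      f.extendScalarsOfSurjective Ideal.Quotient.mk_surjective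
    have hS := g.shortExact_shortComplexKer hf
    have : Projective g.shortComplexKer.X₂ :=
      inferInstanceAs (Projective (ModuleCat.of (Q ⧸ J) (Fin (b 0) → Q ⧸ J)))
    let e : LinearMap.ker f ≃ₗ[Q] LinearMap.ker g :=
      { toFun := fun x => ⟨x.1, x.2⟩
        invFun := fun x => ⟨x.1, x.2⟩
        map_add' := fun _ _ => rfl
        map_smul' := fun _ _ => rfl }
    obtain ⟨P, ⟨α⟩⟩ := ih (hk.congr e)
    obtain ⟨P', -, hs⟩ := hS.exists_projectiveResolution P
    exact ⟨P', ⟨eqToIso (hs i) ≪≫ α⟩⟩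

variable {k R : Type u} [Field k] [CommRing R] [Algebra k R]

lemma rank_restrictScalars_le_of_mono {X Y : ModuleCat.{u} R} (f : X ⟶ Y) [Mono f] :
    Module.rank k (RestrictScalars k R X) ≤ Module.rank k (RestrictScalars k R Y) := by
  let g : RestrictScalars k R X →ₗ[k] RestrictScalars k R Y :=
    { toFun := f.hom
      map_add' := f.hom.map_add
      map_smul' := fun c x => f.hom.map_smul (algebraMap k R c) x }
  exact LinearMap.rank_le_of_injective g ((ModuleCat.mono_iff_injective f).1 inferInstance)

lemma rank_restrictScalars_le_of_epi {X Y : ModuleCat.{u} R} (f : X ⟶ Y) [Epi f] :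
    Module.rank k (RestrictScalars k R Y) ≤ Module.rank k (RestrictScalars k R X) := by
  let g : RestrictScalars k R X →ₗ[k] RestrictScalars k R Y :=
    { toFun := f.hom
      map_add' := f.hom.map_add
      map_smul' := fun c x => f.hom.map_smul (algebraMap k R c) x }
  exact LinearMap.rank_le_of_surjective g ((ModuleCat.epi_iff_surjective f).1 inferInstance)

/-- If `M` is spanned over `k` by one element, then `M ⊗ R ^ b` has dimension at most `b`. -/
lemma rank_tensor_free_le {M : Type u} [AddCommGroup M] [Module R M] (m₀ : M)
    (hm : ∀ x : M, ∃ c : k, algebraMap k R c • m₀ = x) (b : ℕ) :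
    Module.rank k (RestrictScalars k R (M ⊗[R] (Fin b → R))) ≤ b := by
  let φ : (Fin b → k) →ₗ[k] RestrictScalars k R (M ⊗[R] (Fin b → R)) :=
    { toFun := fun c => (m₀ ⊗ₜ[R] fun i => algebraMap k R (c i) : M ⊗[R] (Fin b → R))
      map_add' := fun c d => by
        refine Eq.trans ?_ (TensorProduct.tmul_add m₀ _ _)
        congr 1; ext i; simp
      map_smul' := fun c d => by
        refine Eq.trans ?_ (TensorProduct.tmul_smul (algebraMap k R c) m₀ _)
        congr 1; ext i; simp }
  have hφ : Function.Surjective φ := fun y => by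
    let e := TensorProduct.piScalarRight R R M (Fin b)
    choose c hc using fun i => hm (e y i)
    refine ⟨c, e.injective (funext fun i => ?_)⟩
    rw [← hc i]
    exact congrFun (TensorProduct.piScalarRight_apply R R M (Fin b) _) i
  simpa using LinearMap.rank_le_of_surjective φ hφ

lemma rank_tor_le_of_projectiveResolution {M N : ModuleCat.{u} R} (m₀ : M)
    (hm : ∀ x : M, ∃ c : k, algebraMap k R c • m₀ = x) (i b : ℕ) (P : ProjectiveResolution N)
    (e : P.complex.X i ≅ ModuleCat.of R (Fin b → R)) :
    Module.rank k (RestrictScalars k R (((Tor (ModuleCat.{u} R) i).obj M).obj N)) ≤ b := by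
  let F := (MonoidalCategory.tensoringLeft (ModuleCat.{u} R)).obj M
  let K := (F.mapHomologicalComplex (ComplexShape.down ℕ)).obj P.complex
  let α : ((Tor (ModuleCat.{u} R) i).obj M).obj N ≅ K.homology i := P.isoLeftDerivedObj F i
  let β : K.X i ≅ F.obj (ModuleCat.of R (Fin b → R)) := F.mapIso e
  calc _ ≤ Module.rank k (RestrictScalars k R (K.homology i)) :=
        rank_restrictScalars_le_of_mono α.hom
    _ ≤ Module.rank k (RestrictScalars k R (K.cycles i)) :=
        rank_restrictScalars_le_of_epi (K.homologyπ i)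
    _ ≤ Module.rank k (RestrictScalars k R (K.X i)) :=
        rank_restrictScalars_le_of_mono (K.iCycles i)
    _ ≤ Module.rank k (RestrictScalars k R (F.obj (ModuleCat.of R (Fin b → R)))) :=
        rank_restrictScalars_le_of_mono β.hom
    _ ≤ b := rank_tensor_free_le m₀ hm b

end TorBound

/-- Let `I = ⟨m₁,…,m_r⟩` be a monomial ideal in `Q = 𝕜[x₁,…,xₙ]` (with
`m_j = x^{v j}`), let `a₁,…,a_c` be a regular sequence of homogeneous polynomials of positive
degree contained in `I`, and let `R = Q/⟨a₁,…,a_c⟩` with graded maximal ideal `𝔪_R`. Then for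
every `m ≥ 0` the odd total Betti numbers of `R/I` over `R` satisfy
`β_{2m+1}(R/I) = dim_𝕜 Tor^R_{2m+1}(R/𝔪_R, R/IR) ≤ Σ_{j=0}^{m} C(r,2j+1)·C(c+m−j−1, c−1)`. -/
theorem odd_betti_bound {𝕜 : Type*} [Field 𝕜] {n r c : ℕ}
    (v : Fin r → (Fin n →₀ ℕ)) (a : Fin c → MvPolynomial (Fin n) 𝕜)
    (hreg : RingTheory.Sequence.IsRegular (MvPolynomial (Fin n) 𝕜) (List.ofFn a))
    (hhom : ∀ i, ∃ d : ℕ, 0 < d ∧ (a i).IsHomogeneous d)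
    (hmem : ∀ i, a i ∈ Ideal.span (Set.range fun j => monomial (v j) (1 : 𝕜))) :
    ∀ m : ℕ,
      Module.rank 𝕜
        (RestrictScalars 𝕜 (CIRing 𝕜 n c a)
          (((Tor (ModuleCat (CIRing 𝕜 n c a)) (2 * m + 1)).obj
              (ModuleCat.of _ (CIRing 𝕜 n c a ⧸ gradedMaxIdeal 𝕜 n c a))).obj
            (ModuleCat.of _ (CIRing 𝕜 n c a ⧸ extIdeal 𝕜 c v a)))) ≤
      ((∑ j ∈ Finset.range (m + 1),
        Nat.choose r (2 * j + 1) * Nat.choose (c + m - j - 1) (c - 1) : ℕ) : Cardinal) := by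
  intro m
  let I := Ideal.span (Set.range fun j => monomial (v j) (1 : 𝕜))
  let J := Ideal.span (Set.range a)
  have hJI : J ≤ I := Ideal.span_le.2 (by rintro _ ⟨i, rfl⟩; exact hmem i)
  let q : MvPolynomial (Fin n) 𝕜 →ₗ[MvPolynomial (Fin n) 𝕜]
      (CIRing 𝕜 n c a ⧸ extIdeal 𝕜 c v a) :=
    (extIdeal 𝕜 c v a).mkQ.restrictScalars (MvPolynomial (Fin n) 𝕜) ∘ₗ
      Algebra.linearMap (MvPolynomial (Fin n) 𝕜) (CIRing 𝕜 n c a)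
  have hq : Function.Surjective q := fun x => by
    obtain ⟨x, rfl⟩ := Ideal.Quotient.mk_surjective x
    obtain ⟨x, rfl⟩ := Ideal.Quotient.mk_surjective x
    exact ⟨x, rfl⟩
  have hker : I = LinearMap.ker q := by
    ext x
    have h1 : q x = 0 ↔ algebraMap _ (CIRing 𝕜 n c a) x ∈ extIdeal 𝕜 c v a :=
      Ideal.Quotient.eq_zero_iff_mem
    rw [LinearMap.mem_ker, h1, extIdeal]
    constructor
    · exact Ideal.mem_map_of_mem _
    · intro hx
      obtain ⟨y, hy, hxy⟩ :=
        (Ideal.mem_map_iff_of_surjective _ Ideal.Quotient.mk_surjective).1 hx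
      have := hJI (Ideal.Quotient.eq.1 hxy)
      simpa using I.sub_mem hy this
  have hres := (HasFreeRes.completeIntersection v a hreg.toIsWeaklyRegular hmem
    (2 * m + 1 + 1)).congr
      ((Submodule.quotEquivOfEq _ _ hker).trans (q.quotKerEquivOfSurjective hq))
  obtain ⟨P, ⟨e⟩⟩ := hres.exists_projectiveResolution (2 * m + 1)
  refine (rank_tor_le_of_projectiveResolution
    (M := ModuleCat.of _ (CIRing 𝕜 n c a ⧸ gradedMaxIdeal 𝕜 n c a))
    (1 : CIRing 𝕜 n c a ⧸ gradedMaxIdeal 𝕜 n c a) (fun x => ?_) _ _ P e).trans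
    (Nat.cast_le.2 (ciRanks_odd_le r c m))
  obtain ⟨x, rfl⟩ := Ideal.Quotient.mk_surjective x
  obtain ⟨x, rfl⟩ := Ideal.Quotient.mk_surjective x
  refine ⟨constantCoeff x, ?_⟩
  have hx : x - C (constantCoeff x) ∈ Ideal.span (Set.range (X (R := 𝕜) (σ := Fin n))) := by
    rw [← Set.image_univ, mem_ideal_span_X_image]
    intro d hd
    by_contra! h
    have hd0 : d = 0 := Finsupp.ext fun i => by simpa using h i (Set.mem_univ i)
    subst hd0
    simp [mem_support_iff, constantCoeff_eq] at hd
  have hm : Ideal.Quotient.mk (Ideal.span (Set.range a)) (x - C (constantCoeff x)) ∈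
      gradedMaxIdeal 𝕜 n c a := by
    have := Ideal.mem_map_of_mem (Ideal.Quotient.mk (Ideal.span (Set.range a))) hx
    rwa [Ideal.map_span, ← Set.range_comp] at this
  rw [map_sub] at hm
  exact (mul_one _).trans (Ideal.Quotient.eq.2 hm).symm
end
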